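/- arXiv:1905.13317 — 3 statements merged into one kernel-verified Lean document; each statement's English description precedes it below -/
import Mathlib

section
/- Let f : T² → ℝ be a smooth function on the 2-torus with 0 a regular value, and suppose every connected component of f⁻¹(0) is a contractible loop. Then either every loop contained in {f > 0} realizes the trivial homology class, or every loop in {f < 0} does; moreover one of the inclusion-induced maps ι⁺_* : H₁({f>0}) → H₁(T²) and ι⁻_* : H₁({f<0}) → H₁(T²) is surjective while the other is zero. -/
/-- The subgroup of `H₁(T²) ≅ ℤ²` realized by loops lying in the set where the values of `F`
satisfy the predicate `P`: a loop of homology class `v` is a continuous `γ : ℝ → ℝ²` with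
`γ(t+1) = γ(t) + v`. -/
def loopClasses (F : ℝ × ℝ → ℝ) (P : ℝ → Prop) : AddSubgroup (ℤ × ℤ) :=
  AddSubgroup.closure {v : ℤ × ℤ | ∃ γ : ℝ → ℝ × ℝ, Continuous γ ∧
    (∀ t, γ (t + 1) = γ t + ((v.1 : ℝ), (v.2 : ℝ))) ∧ ∀ t, P (F (γ t))}

section THelpers
open Set Filter Topology

def TJump (F : ℝ × ℝ → ℝ) (s h : ℝ × ℝ → ℤ) : Prop :=
  ∀ x, ∀ᶠ y in 𝓝 x, h y = h x + (if F x = 0 ∧ 0 < F y then s x else 0)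

theorem TJump.const {F : ℝ × ℝ → ℝ} {s h : ℝ × ℝ → ℤ} (H : TJump F s h) {S : Set (ℝ × ℝ)}
    (hS : IsPreconnected S) (h0 : ∀ x ∈ S, F x = 0 → s x = 0) {x y : ℝ × ℝ}
    (hx : x ∈ S) (hy : y ∈ S) : h x = h y := by
  refine hS.constant (f := h) ?_ hx hy
  intro z hz
  have : h =ᶠ[𝓝 z] fun _ => h z := by
    filter_upwards [H z] with w hw
    rw [hw]
    split_ifs with hc
    · rw [h0 z hz hc.1]; simp
    · simp
  exact (continuousAt_const.congr this.symm).continuousWithinAt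

theorem TJump.const_zero {F : ℝ × ℝ → ℝ} {s h : ℝ × ℝ → ℤ} (H : TJump F s h) {S : Set (ℝ × ℝ)}
    (hS : IsPreconnected S) (h0 : ∀ x ∈ S, F x = 0) {x y : ℝ × ℝ}
    (hx : x ∈ S) (hy : y ∈ S) : h x = h y := by
  refine hS.constant (f := h) ?_ hx hy
  intro z hz
  have : h =ᶠ[𝓝[S] z] fun _ => h z := by
    filter_upwards [(H z).filter_mono nhdsWithin_le_nhds, self_mem_nhdsWithin] with w hw hwS
    rw [hw, if_neg]
    · simp
    · rw [h0 w hwS]; simp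
  exact (continuousWithinAt_const.congr_of_eventuallyEq this rfl)

theorem TJump.add {F : ℝ × ℝ → ℝ} {s h s' h' : ℝ × ℝ → ℤ} (H : TJump F s h) (H' : TJump F s' h') :
    TJump F (fun x => s x + s' x) (fun x => h x + h' x) := by
  intro x
  filter_upwards [H x, H' x] with y h1 h2
  rw [h1, h2]; split_ifs <;> ring

theorem TJump.smul {F : ℝ × ℝ → ℝ} {s h : ℝ × ℝ → ℤ} (c : ℤ) (H : TJump F s h) :
    TJump F (fun x => c * s x) (fun x => c * h x) := by
  intro x
  filter_upwards [H x] with y h1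
  rw [h1]; split_ifs <;> ring

theorem TJump.sum {F : ℝ × ℝ → ℝ} {ι : Type*} (A : Finset ι) (s h : ι → ℝ × ℝ → ℤ)
    (H : ∀ i ∈ A, TJump F (s i) (h i)) :
    TJump F (fun x => ∑ i ∈ A, s i x) (fun x => ∑ i ∈ A, h i x) := by
  intro x
  have : ∀ᶠ y in 𝓝 x, ∀ i ∈ A, h i y = h i x + (if F x = 0 ∧ 0 < F y then s i x else 0) :=
    (Filter.eventually_all_finset A).2 fun i hi => H i hi x
  filter_upwards [this] with y hy
  rw [Finset.sum_congr rfl hy, Finset.sum_add_distrib]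
  split_ifs <;> simp

/-- existence of a primitive -/
theorem TJump.exists {F : ℝ × ℝ → ℝ} (hF : Continuous F) (s : ℝ × ℝ → ℤ)
    (hs : ContinuousOn s {x | F x = 0}) : ∃ h, TJump F s h := by
  have hcl : IsClosed {x | F x = 0} := isClosed_eq hF continuous_const
  obtain ⟨g, hg⟩ := ContinuousMap.exists_restrict_eq hcl
    (⟨fun x : {x | F x = 0} => ((s x : ℤ) : ℝ), by
      have := continuousOn_iff_continuous_domRestrict.1 hs
      exact continuous_of_discreteTopology.comp this⟩ : C({x | F x = 0}, ℝ))
  have hg' : ∀ x, F x = 0 → g x = s x := fun x hx => by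
    have := congrArg (fun f => f ⟨x, hx⟩) hg
    simpa using this
  let θ : C(ℝ × ℝ, Circle) := ⟨fun x => if F x ≤ 0 then 1 else Circle.exp (2 * Real.pi * g x), by
    refine Continuous.if_le continuous_const (by fun_prop) hF continuous_const ?_
    intro x hx
    rw [hg' x hx]
    have := Circle.exp_eq_one (r := 2 * Real.pi * (s x : ℝ))
    symm
    rw [this]
    exact ⟨s x, by ring⟩⟩
  obtain ⟨e₀, he₀⟩ : ∃ e₀, Circle.exp e₀ = θ 0 := by
    exact ⟨_, Circle.exp_arg (θ 0)⟩
  obtain ⟨G, ⟨-, hG⟩, -⟩ := Circle.isCoveringMap_exp.existsUnique_continuousMap_lifts θ 0 e₀ he₀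
  have hG' : ∀ x, Circle.exp (G x) = θ x := fun x => congrFun hG x
  have key : ∀ x, ∃ n : ℤ, (if F x ≤ 0 then 0 else g x) - G x / (2 * Real.pi) = n := by
    intro x
    have h1 := hG' x
    have : Circle.exp (2 * Real.pi * (if F x ≤ 0 then 0 else g x)) = θ x := by
      simp only [θ, ContinuousMap.coe_mk]
      split_ifs <;> simp
    rw [← this] at h1
    obtain ⟨m, hm⟩ := Circle.exp_eq_exp.1 h1
    refine ⟨-m, ?_⟩
    have := Real.pi_pos
    rw [hm]; field_simp; push_cast; ring
  choose h hh using key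
  refine ⟨h, fun x => ?_⟩
  have hGc : ContinuousAt (fun y => G y / (2 * Real.pi)) x := by fun_prop
  have hgc : ContinuousAt g x := by fun_prop
  have e1 := Metric.continuousAt_iff'.1 hGc (1/4) (by norm_num)
  have e2 := Metric.continuousAt_iff'.1 hgc (1/4) (by norm_num)
  have e3 : ∀ᶠ y in 𝓝 x, F x ≠ 0 → (F y ≤ 0 ↔ F x ≤ 0) := by
    rcases lt_trichotomy (F x) 0 with hx | hx | hx
    · filter_upwards [hF.continuousAt.eventually_lt continuousAt_const hx] with y hy _
      exact ⟨fun _ => hx.le, fun _ => hy.le⟩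
    · simp [hx]
    · filter_upwards [continuousAt_const.eventually_lt hF.continuousAt hx] with y hy _
      exact ⟨fun h => absurd hy (not_lt.2 h), fun h => absurd hx (not_lt.2 h)⟩
  filter_upwards [e1, e2, e3] with y h1 h2 h3
  rw [Real.dist_eq, abs_lt] at h1 h2
  have hx := hh x
  have hy := hh y
  have aux : ∀ a b : ℤ, |(a:ℝ) - b| < 1 → a = b := by
    intro a b hab
    have : |a - b| < 1 := by exact_mod_cast hab
    have := Int.abs_lt_one_iff.1 this
    omega
  apply aux
  rw [abs_lt]
  push_cast
  rw [← hx, ← hy]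
  by_cases hz : F x = 0
  · have := hg' x hz
    by_cases hy0 : 0 < F y
    · simp only [hz, hy0, not_le.2 hy0, this] at *
      simp; constructor <;> linarith
    · simp only [hz, hy0, not_lt.1 hy0] at *
      simp; constructor <;> linarith
  · have := h3 hz
    by_cases hx0 : F x ≤ 0
    · simp [hx0, this.2 hx0, hz]; constructor <;> linarith
    · have : ¬ F y ≤ 0 := fun h => hx0 (this.1 h)
      simp [hx0, this, hz]; constructor <;> linarith

theorem TJump.normalize {F : ℝ × ℝ → ℝ} (hF : Continuous F) (s : ℝ × ℝ → ℤ)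
    (hs : ContinuousOn s {x | F x = 0}) (R : ℝ) (hR : ∀ x, R < ‖x‖ → s x = 0) :
    ∃ h, TJump F s h ∧ ∀ x, R < ‖x‖ → h x = 0 := by
  obtain ⟨h, H⟩ := TJump.exists hF s hs
  have hH : IsPreconnected {x : ℝ × ℝ | R < ‖x‖} := by
    have c1 : IsPreconnected {x : ℝ × ℝ | R < x.1} :=
      (convex_halfSpace_gt (f := Prod.fst) ⟨fun _ _ => rfl, fun _ _ => rfl⟩ R).isPreconnected
    have c2 : IsPreconnected {x : ℝ × ℝ | R < x.2} :=
      (convex_halfSpace_gt (f := Prod.snd) ⟨fun _ _ => rfl, fun _ _ => rfl⟩ R).isPreconnected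
    have c3 : IsPreconnected {x : ℝ × ℝ | x.1 < -R} :=
      (convex_halfSpace_lt (f := Prod.fst) ⟨fun _ _ => rfl, fun _ _ => rfl⟩ (-R)).isPreconnected
    have c4 : IsPreconnected {x : ℝ × ℝ | x.2 < -R} :=
      (convex_halfSpace_lt (f := Prod.snd) ⟨fun _ _ => rfl, fun _ _ => rfl⟩ (-R)).isPreconnected
    have d1 := IsPreconnected.union ((R+1, R+1) : ℝ × ℝ) (by simp) (by simp) c1 c2
    have d2 := IsPreconnected.union ((-R-1, R+1) : ℝ × ℝ) (by simp) (by simp) d1 c3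
    have d3 := IsPreconnected.union ((-R-1, -R-1) : ℝ × ℝ) (by simp) (by simp) d2 c4
    convert d3 using 1
    ext x
    simp only [mem_ofPred_eq, mem_union, Prod.norm_def, lt_sup_iff, Real.norm_eq_abs, lt_abs]
    constructor
    · rintro ((h|h)|(h|h))
      · simp [h]
      · left; right; linarith
      · simp [h]
      · right; linarith
    · rintro (((h|h)|h)|h)
      · simp [h]
      · simp [h]
      · left; right; linarith
      · right; right; linarith
  let a : ℝ × ℝ := (|R| + 1, 0)
  have ha : R < ‖a‖ := by
    have h1 := norm_fst_le a
    simp only [a, Real.norm_eq_abs] at h1 ⊢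
    have := le_abs_self R
    have := le_abs_self (|R| + 1)
    linarith
  refine ⟨fun x => h x - h a, fun x => ?_, fun x hx => ?_⟩
  · filter_upwards [H x] with y hy
    rw [hy]; ring
  · have := H.const hH (fun x hx _ => hR x hx) hx ha
    simp only [this, sub_self]

/-- local structure -/
theorem T_local {F : ℝ × ℝ → ℝ} (hF : ContDiff ℝ (⊤ : ℕ∞) F) {x : ℝ × ℝ} (hx : F x = 0)
    (hd : fderiv ℝ F x ≠ 0) {W : Set (ℝ × ℝ)} (hW : W ∈ 𝓝 x) :
    ∃ N ∈ 𝓝 x, N ⊆ W ∧ IsPathConnected (N ∩ {y | 0 < F y}) ∧ IsPathConnected (N ∩ {y | F y < 0}) ∧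
      IsPathConnected (N ∩ {y | F y = 0}) := by
  have hs : HasStrictFDerivAt F (fderiv ℝ F x) x :=
    (hF.contDiffAt).hasStrictFDerivAt (by simp)
  have hr : (fderiv ℝ F x).range = ⊤ := by
    apply LinearMap.range_eq_top.2
    apply LinearMap.surjective
    intro h
    apply hd
    exact ContinuousLinearMap.coe_injective h
  let e := hs.implicitToOpenPartialHomeomorph F (fderiv ℝ F x) hr
  have hxs : x ∈ e.source := hs.mem_implicitToOpenPartialHomeomorph_source hr
  have he1 : ∀ y, (e y).1 = F y := fun y => hs.implicitToOpenPartialHomeomorph_fst hr y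
  have hex : e x = (0, 0) := by
    have := hs.implicitToOpenPartialHomeomorph_self hr
    rw [hx] at this
    exact this
  have hW' : e.symm ⁻¹' W ∩ e.target ∈ 𝓝 (e x) := by
    refine inter_mem ?_ (e.open_target.mem_nhds (e.map_source hxs))
    refine (e.symm.continuousAt (by exact (e.map_source hxs))).preimage_mem_nhds ?_
    rw [e.left_inv hxs]; exact hW
  obtain ⟨r, hr0, hb⟩ := Metric.mem_nhds_iff.1 hW'
  set D := Metric.ball (e x) r with hD
  have hDc : Convex ℝ D := convex_ball _ _
  have hsub : D ⊆ e.target := fun z hz => (hb hz).2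
  have hF' : ∀ z ∈ D, F (e.symm z) = z.1 := fun z hz => by
    rw [← he1, e.right_inv (hsub hz)]
  have hsc : ContinuousOn e.symm D := e.continuousOn_symm.mono hsub
  have hmem : ∀ t : ℝ, |t| < r → ((t, 0) : ℝ × (fderiv ℝ F x).ker) ∈ D := by
    intro t ht
    rw [hD, hex, Metric.mem_ball, Prod.dist_eq]
    simp [ht]
  have gen : ∀ P : ℝ → Prop, Convex ℝ {t | P t} → (∃ t, |t| < r ∧ P t) →
      IsPathConnected (e.symm '' D ∩ {y | P (F y)}) := by
    rintro P hP ⟨t, ht, hPt⟩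
    have : e.symm '' D ∩ {y | P (F y)} = e.symm '' (D ∩ {z | P z.1}) := by
      ext y
      constructor
      · rintro ⟨⟨z, hz, rfl⟩, h2⟩
        refine ⟨z, ⟨hz, ?_⟩, rfl⟩
        have h3 : P (F (e.symm z)) := h2
        rw [hF' z hz] at h3
        exact h3
      · rintro ⟨z, ⟨hz, h2⟩, rfl⟩
        refine ⟨⟨z, hz, rfl⟩, ?_⟩
        change P (F (e.symm z))
        rw [hF' z hz]
        exact h2
    rw [this]
    refine IsPathConnected.image' ?_ (hsc.mono inter_subset_left)
    refine Convex.isPathConnected (hDc.inter ?_) ⟨(t, 0), hmem t ht, hPt⟩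
    exact hP.is_linear_preimage (f := Prod.fst) ⟨fun _ _ => rfl, fun _ _ => rfl⟩
  have hr2 : |r / 2| < r := by rw [abs_of_pos] <;> linarith
  refine ⟨e.symm '' D, ?_, ?_, gen _ (convex_Ioi 0) ⟨r / 2, hr2, by simpa using hr0⟩,
    gen _ (convex_Iio 0) ⟨-(r / 2), by rwa [abs_neg], by linarith⟩,
    gen _ (convex_singleton 0) ⟨0, by simpa using hr0, rfl⟩⟩
  · have : e.symm '' D ∈ 𝓝 (e.symm (e x)) :=
      e.symm.image_mem_nhds (by exact e.map_source hxs) (Metric.ball_mem_nhds _ hr0)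
    rwa [e.left_inv hxs] at this
  · rintro _ ⟨z, hz, rfl⟩
    exact (hb hz).1

/-- path components of the zero set -/
abbrev TC (F : ℝ × ℝ → ℝ) (x : ℝ × ℝ) : Set (ℝ × ℝ) := pathComponentIn {y | F y = 0} x

abbrev Tvec (v : ℤ × ℤ) : ℝ × ℝ := ((v.1 : ℝ), (v.2 : ℝ))

def TLoc (F : ℝ × ℝ → ℝ) : Prop := ∀ x, F x = 0 → ∀ W ∈ 𝓝 x,
  ∃ N ∈ 𝓝 x, N ⊆ W ∧ IsPathConnected (N ∩ {y | 0 < F y}) ∧ IsPathConnected (N ∩ {y | F y < 0}) ∧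
      IsPathConnected (N ∩ {y | F y = 0})

def TPer (F : ℝ × ℝ → ℝ) : Prop := ∀ (x : ℝ × ℝ) (m : ℤ × ℤ), F (x + Tvec m) = F x

theorem TC_mem_iff {F : ℝ × ℝ → ℝ} {x z w : ℝ × ℝ} (h : w ∈ TC F z) : w ∈ TC F x ↔ z ∈ TC F x :=
  ⟨fun h1 => JoinedIn.trans h1 (JoinedIn.symm h), fun h1 => JoinedIn.trans h1 h⟩

theorem TC_zero {F : ℝ × ℝ → ℝ} {x w : ℝ × ℝ} (h : w ∈ TC F x) : F w = 0 :=
  pathComponentIn_subset (F := {y | F y = 0}) h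

theorem TC_preconn {F : ℝ × ℝ → ℝ} {x : ℝ × ℝ} (h : F x = 0) : IsPreconnected (TC F x) :=
  (isPathConnected_pathComponentIn (F := {y | F y = 0}) h).isConnected.isPreconnected

theorem TC_self {F : ℝ × ℝ → ℝ} {x : ℝ × ℝ} (h : F x = 0) : x ∈ TC F x :=
  mem_pathComponentIn_self (F := {y | F y = 0}) h

theorem TC_nhds {F : ℝ × ℝ → ℝ} (hA : TLoc F) {x : ℝ × ℝ} (hx : F x = 0) :
    ∀ᶠ w in 𝓝 x, F w = 0 → w ∈ TC F x := by
  obtain ⟨N, hN, -, -, -, hp⟩ := hA x hx univ univ_mem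
  filter_upwards [hN] with w hw h0
  exact hp.subset_pathComponentIn ⟨mem_of_mem_nhds hN, hx⟩ inter_subset_right ⟨hw, h0⟩

theorem TC_closed {F : ℝ × ℝ → ℝ} (hF : Continuous F) (hA : TLoc F) (x : ℝ × ℝ) :
    IsClosed (TC F x) := by
  refine isClosed_of_closure_subset fun z hz => ?_
  have hcl : IsClosed {x | F x = 0} := isClosed_eq hF continuous_const
  have hz0 : F z = 0 := closure_minimal pathComponentIn_subset hcl hz
  obtain ⟨w, hw, hwx⟩ := mem_closure_iff_nhds.1 hz _ (TC_nhds hA hz0)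
  exact (TC_mem_iff (hw (TC_zero hwx))).1 hwx

open Classical in
noncomputable def TI (S : Set (ℝ × ℝ)) (x : ℝ × ℝ) : ℤ := if x ∈ S then 1 else 0

theorem TI_congr {S S' : Set (ℝ × ℝ)} {x x' : ℝ × ℝ} (h : x ∈ S ↔ x' ∈ S') :
    TI S x = TI S' x' := by
  by_cases h' : x' ∈ S'
  · have := h.2 h'
    simp only [TI]
    rw [if_pos this, if_pos h']
  · have := mt h.1 h'
    simp only [TI]
    rw [if_neg this, if_neg h']

theorem TI_cont {F : ℝ × ℝ → ℝ} (hA : TLoc F) (x : ℝ × ℝ) :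
    ContinuousOn (TI (TC F x)) {x | F x = 0} := by
  intro z hz
  refine (continuousWithinAt_const (b := TI (TC F x) z)).congr_of_eventuallyEq ?_ rfl
  filter_upwards [(TC_nhds hA hz).filter_mono nhdsWithin_le_nhds, self_mem_nhdsWithin] with w h1 h2
  have := TC_mem_iff (x := x) (h1 h2)
  exact TI_congr this

theorem T_join_add {F : ℝ × ℝ → ℝ} (hper : TPer F) (P : ℝ → Prop) {x z : ℝ × ℝ} (v : ℤ × ℤ)
    (h : JoinedIn {y | P (F y)} x z) : JoinedIn {y | P (F y)} (x + Tvec v) (z + Tvec v) := by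
  obtain ⟨p, hp⟩ := h
  refine ⟨p.map (f := fun y => y + Tvec v) (by fun_prop), fun t => ?_⟩
  have := hp t
  change P (F (p t + Tvec v))
  rw [hper]; exact this

theorem TC_add {F : ℝ × ℝ → ℝ} (hper : TPer F) {x z : ℝ × ℝ} (v : ℤ × ℤ) :
    z + Tvec v ∈ TC F (x + Tvec v) ↔ z ∈ TC F x := by
  refine ⟨fun h => ?_, fun h => T_join_add hper (fun a => a = 0) v h⟩
  have := T_join_add hper (fun a => a = 0) (-v) h
  have e : ∀ x : ℝ × ℝ, x + Tvec v + Tvec (-v) = x := fun x => by ext <;> simp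
  rw [e, e] at this
  exact this

theorem T_loop {F : ℝ × ℝ → ℝ} (hper : TPer F) (P : ℝ → Prop) {x : ℝ × ℝ} {v : ℤ × ℤ}
    (h : JoinedIn {y | P (F y)} x (x + Tvec v)) :
    ∃ γ : ℝ → ℝ × ℝ, Continuous γ ∧ (∀ t, γ (t + 1) = γ t + ((v.1 : ℝ), (v.2 : ℝ))) ∧
      ∀ t, P (F (γ t)) := by
  obtain ⟨p, hp⟩ := h
  let q : ℝ → ℝ × ℝ := fun t => p.extend t - t • Tvec v
  have hq : Continuous (q ∘ Int.fract) := by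
    refine ContinuousOn.comp_fract'' (Continuous.continuousOn ?_) ?_
    · exact p.continuous_extend.sub (by fun_prop)
    · simp [q]
  refine ⟨fun t => q (Int.fract t) + t • Tvec v, by exact hq.add (by fun_prop), fun t => ?_,
    fun t => ?_⟩
  · simp only [Int.fract_add_one, add_smul, one_smul, add_assoc]
  · have e : q (Int.fract t) + t • Tvec v = p.extend (Int.fract t) + Tvec (⌊t⌋ • v) := by
      have : t • Tvec v = Int.fract t • Tvec v + Tvec (⌊t⌋ • v) := by
        have ht := Int.fract_add_floor t
        ext <;> simp <;> nth_rw 1 [← ht] <;> ring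
      simp only [q, this]
      abel
    change P (F (q (Int.fract t) + t • Tvec v))
    rw [e, hper]
    rw [p.extend_apply ⟨Int.fract_nonneg t, (Int.fract_lt_one t).le⟩]
    exact hp _

theorem T_fund (x : ℝ × ℝ) : ∃ v : ℤ × ℤ, x + Tvec v ∈ Icc (0 : ℝ × ℝ) 1 := by
  refine ⟨(-⌊x.1⌋, -⌊x.2⌋), ?_⟩
  have a := Int.floor_le x.1
  have b := Int.floor_le x.2
  have a' := Int.lt_floor_add_one x.1
  have b' := Int.lt_floor_add_one x.2
  constructor <;> constructor <;> simp <;> linarith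

def TNo (F : ℝ × ℝ → ℝ) : Prop := ∀ x v, x + Tvec v ∈ TC F x → v = 0

theorem TC_bdd {F : ℝ × ℝ → ℝ} (hF : Continuous F) (hA : TLoc F) (hper : TPer F) (hno : TNo F)
    (x : ℝ × ℝ) : Bornology.IsBounded (TC F x) := by
  have hcl : IsClosed {x | F x = 0} := isClosed_eq hF continuous_const
  have hK : IsCompact (Icc (0 : ℝ × ℝ) 1 ∩ {x | F x = 0}) := isCompact_Icc.inter_right hcl
  obtain ⟨t, ht, hcov⟩ := hK.elim_nhds_subcover (fun z => {w | F w = 0 → w ∈ TC F z})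
    (fun z hz => TC_nhds hA hz.2)
  have hb : Bornology.IsBounded (⋃ i ∈ t, ⋃ v ∈ {v : ℤ × ℤ | i + Tvec v ∈ TC F x},
      (fun z => z + Tvec v) '' (Icc (0 : ℝ × ℝ) 1)) := by
    refine (Bornology.isBounded_biUnion_finset t).2 fun i hi => ?_
    refine (Bornology.isBounded_biUnion ?_).2 fun v hv => ?_
    · refine Set.Subsingleton.finite fun v hv w hw => ?_
      have h1 : i + Tvec v ∈ TC F (i + Tvec w) := JoinedIn.trans (JoinedIn.symm hw) hv
      have e : i + Tvec v = (i + Tvec w) + Tvec (v - w) := by ext <;> simp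
      rw [e] at h1
      have := hno _ _ h1
      exact sub_eq_zero.1 this
    · exact (isCompact_Icc.image (by fun_prop)).isBounded
  refine hb.subset fun z hz => ?_
  obtain ⟨v, hv⟩ := T_fund z
  have hz0 : F z = 0 := TC_zero hz
  have hz1 : F (z + Tvec v) = 0 := by rw [hper, hz0]
  obtain ⟨i, hi, hzi⟩ := mem_iUnion₂.1 (hcov ⟨hv, hz1⟩)
  have hzi' := hzi hz1
  have e : z + Tvec v + Tvec (-v) = z := by ext <;> simp
  refine mem_iUnion₂.2 ⟨i, hi, mem_iUnion₂.2 ⟨-v, ?_, ⟨_, hv, e⟩⟩⟩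
  have h2 := (TC_add hper (-v)).2 hzi'
  rw [e] at h2
  exact (TC_mem_iff h2).1 hz

def TOut (F : ℝ × ℝ → ℝ) (y : ℝ × ℝ) : Prop := ∀ x, F x = 0 → ∀ h R,
  TJump F (TI (TC F x)) h → (∀ z, R < ‖z‖ → h z = 0) → h y = 0

theorem T_exists {F : ℝ × ℝ → ℝ} (hF : Continuous F) (hA : TLoc F) (hper : TPer F) (hno : TNo F)
    (x : ℝ × ℝ) : ∃ h R, TJump F (TI (TC F x)) h ∧ (∀ z, R < ‖z‖ → h z = 0) := by
  obtain ⟨R, hR⟩ := (TC_bdd hF hA hper hno x).exists_norm_le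
  obtain ⟨h, h1, h2⟩ := TJump.normalize hF (TI (TC F x)) (TI_cont hA x) R (fun z hz => by
    simp only [TI]
    rw [if_neg]
    intro hz'
    exact absurd (hR z hz') (not_le.2 hz))
  exact ⟨h, R, h1, h2⟩

theorem T_K {F : ℝ × ℝ → ℝ} (hF : Continuous F) (hA : TLoc F) (hper : TPer F) (hno : TNo F)
    {s b : ℝ × ℝ → ℤ} (H : TJump F s b) (hs : ContinuousOn s {x | F x = 0}) {y y' : ℝ × ℝ}
    (hy : TOut F y) (hy' : TOut F y') : b y = b y' := by
  classical
  have hcl : IsClosed {x | F x = 0} := isClosed_eq hF continuous_const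
  have hT : IsCompact (segment ℝ y y') := by
    rw [segment_eq_image_lineMap]
    exact isCompact_Icc.image (by fun_prop)
  have hK := hT.inter_right hcl
  obtain ⟨t, ht, hcov⟩ := hK.elim_nhds_subcover (fun z => {w | F w = 0 → w ∈ TC F z})
    (fun z hz => TC_nhds hA hz.2)
  let A : Finset (Set (ℝ × ℝ)) := t.image (TC F)
  have hS : ∀ S ∈ A, ∃ (h : ℝ × ℝ → ℤ) (c : ℤ), TJump F (TI S) h ∧ h y = 0 ∧ h y' = 0 ∧
      ∀ z ∈ S, s z = c := by
    intro S hS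
    obtain ⟨x, hx, rfl⟩ := Finset.mem_image.1 hS
    have hx0 : F x = 0 := (ht x hx).2
    obtain ⟨h, R, h1, h2⟩ := T_exists hF hA hper hno x
    refine ⟨h, s x, h1, hy x hx0 h R h1 h2, hy' x hx0 h R h1 h2, fun z hz => ?_⟩
    exact (TC_preconn hx0).constant (hs.mono pathComponentIn_subset) hz (TC_self hx0)
  choose! h c hh using hS
  have J := H.add (TJump.sum A (fun S x => -c S * TI S x) (fun S x => -c S * h S x)
    (fun S hS => (hh S hS).1.smul _))
  have := J.const (convex_segment y y').isPreconnected ?_ (left_mem_segment ℝ y y')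
    (right_mem_segment ℝ y y')
  · rw [Finset.sum_eq_zero, Finset.sum_eq_zero] at this
    · simpa using this
    · intro S hS; rw [(hh S hS).2.2.1]; simp
    · intro S hS; rw [(hh S hS).2.1]; simp
  · intro z hz hz0
    obtain ⟨i, hi, hzi⟩ := mem_iUnion₂.1 (hcov ⟨hz, hz0⟩)
    have hzi' := hzi hz0
    have hmem : TC F i ∈ A := Finset.mem_image_of_mem _ hi
    rw [Finset.sum_eq_single (TC F i)]
    · rw [(hh _ hmem).2.2.2 z hzi']
      simp [TI, hzi']
    · intro S hS hne
      obtain ⟨x, hx, rfl⟩ := Finset.mem_image.1 hS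
      have : z ∉ TC F x := by
        intro hzx
        exact hne ((pathComponentIn_congr hzx).symm.trans (pathComponentIn_congr hzi'))
      simp [TI, this]
    · intro h; exact absurd hmem h

theorem T_far (R : ℝ) : ∃ a : ℝ × ℝ, R < ‖a‖ := by
  refine ⟨(|R| + 1, 0), ?_⟩
  have h1 := norm_fst_le ((|R| + 1, 0) : ℝ × ℝ)
  simp only [Real.norm_eq_abs] at h1
  have := le_abs_self R
  have := le_abs_self (|R| + 1)
  linarith

theorem TI_eq_zero {S : Set (ℝ × ℝ)} {x : ℝ × ℝ} (h : x ∉ S) : TI S x = 0 := by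
  simp only [TI]; rw [if_neg h]

theorem TI_eq_one {S : Set (ℝ × ℝ)} {x : ℝ × ℝ} (h : x ∈ S) : TI S x = 1 := by
  simp only [TI]; rw [if_pos h]

theorem T_ray {F : ℝ × ℝ → ℝ} {x p q : ℝ × ℝ} {h : ℝ × ℝ → ℤ} {R : ℝ}
    (H : TJump F (TI (TC F x)) h) (hR : ∀ z, R < ‖z‖ → h z = 0) (hp : F p = 0)
    (hpx : p ∉ TC F x) (hne : h p ≠ 0) (hq : q ∈ TC F p) (σ : ℝ) (hσ : |σ| = 1) :
    ∃ t > 0, q + (σ * t, 0) ∈ TC F x := by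
  have hdisj : ∀ z ∈ TC F p, z ∉ TC F x := fun z hz hzx => hpx ((TC_mem_iff hz).1 hzx)
  have hqp : h q = h p := H.const (TC_preconn hp) (fun z hz _ => TI_eq_zero (hdisj z hz)) hq
    (TC_self hp)
  by_contra! hcon
  have hS : IsPreconnected ((fun t : ℝ => q + ((σ * t, 0) : ℝ × ℝ)) '' Ici 0) :=
    isPreconnected_Ici.image _ (by fun_prop)
  have hc : ∀ z ∈ ((fun t : ℝ => q + ((σ * t, 0) : ℝ × ℝ)) '' Ici 0), z ∉ TC F x := by
    rintro _ ⟨t, ht, rfl⟩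
    rcases (show (0:ℝ) ≤ t from ht).eq_or_lt with h0 | h0
    · change q + (σ * t, 0) ∉ TC F x
      rw [← h0, mul_zero, Prod.mk_zero_zero, add_zero]; exact hdisj q hq
    · exact hcon t h0
  set T : ℝ := |R| + |q.1| + 1
  have hT : 0 ≤ T := by positivity
  have h1 : h (q + (σ * 0, 0)) = h (q + (σ * T, 0)) :=
    H.const hS (fun z hz _ => TI_eq_zero (hc z hz)) ⟨0, by simp, rfl⟩ ⟨T, hT, rfl⟩
  rw [hR (q + (σ * T, 0))] at h1
  · apply hne
    rw [← hqp, ← h1, mul_zero, Prod.mk_zero_zero, add_zero]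
  · have h2 := norm_fst_le (q + (σ * T, 0))
    simp only [Prod.fst_add, Real.norm_eq_abs] at h2
    have h3 := abs_sub_abs_le_abs_sub (σ * T) (-q.1)
    rw [abs_mul, hσ, abs_of_nonneg hT, abs_neg, sub_neg_eq_add, add_comm (σ * T)] at h3
    have := le_abs_self R
    simp only [T] at h3 h2
    linarith

theorem T_out_exists {F : ℝ × ℝ → ℝ} (hF : Continuous F) (hA : TLoc F) (hper : TPer F)
    (hno : TNo F) : ∃ y, F y ≠ 0 ∧ TOut F y := by
  by_cases hZ : ∃ x, F x = 0
  swap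
  · push Not at hZ
    exact ⟨0, hZ 0, fun x hx => absurd hx (hZ x)⟩
  have hcl : IsClosed {x | F x = 0} := isClosed_eq hF continuous_const
  have hK : IsCompact (Icc (0 : ℝ × ℝ) 1 ∩ {x | F x = 0}) := isCompact_Icc.inter_right hcl
  let w : ℝ × ℝ → ℝ := fun x => Metric.diam (Prod.fst '' TC F x)
  have hw : ContinuousOn w (Icc (0 : ℝ × ℝ) 1 ∩ {x | F x = 0}) := by
    intro z hz
    refine (continuousWithinAt_const (b := w z)).congr_of_eventuallyEq ?_ rfl
    filter_upwards [(TC_nhds hA hz.2).filter_mono nhdsWithin_le_nhds, self_mem_nhdsWithin]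
      with u h1 h2
    have : TC F u = TC F z := pathComponentIn_congr (h1 h2.2)
    simp only [w, this]
  have hwp : ∀ x v, w (x + Tvec v) = w x := by
    intro x v
    have : Prod.fst '' TC F (x + Tvec v) = (fun a : ℝ => a + v.1) '' (Prod.fst '' TC F x) := by
      rw [image_image]
      ext a
      constructor
      · rintro ⟨z, hz, rfl⟩
        refine ⟨z - Tvec v, ?_, by simp⟩
        rw [← TC_add hper v, sub_add_cancel]
        exact hz
      · rintro ⟨z, hz, rfl⟩
        exact ⟨z + Tvec v, (TC_add hper v).2 hz, by simp⟩
    simp only [w, this]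
    exact (isometry_add_right _).diam_image _
  have hKn : (Icc (0 : ℝ × ℝ) 1 ∩ {x | F x = 0}).Nonempty := by
    obtain ⟨x, hx⟩ := hZ
    obtain ⟨v, hv⟩ := T_fund x
    exact ⟨_, hv, by change F _ = 0; rw [hper, hx]⟩
  obtain ⟨p, ⟨-, hp⟩, hmax⟩ := hK.exists_isMaxOn hKn hw
  replace hp : F p = 0 := hp
  have hmax' : ∀ x, F x = 0 → w x ≤ w p := by
    intro x hx
    obtain ⟨v, hv⟩ := T_fund x
    rw [← hwp x v]
    exact hmax ⟨hv, by change F _ = 0; rw [hper, hx]⟩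
  obtain ⟨h, R, H, hR⟩ := T_exists hF hA hper hno p
  have hk : h p = 0 ∨ h p = -1 := by
    let g : ℝ × ℝ → ℤ := fun z => if h z = h p ∨ h z = h p + 1 then 1 else 0
    have hg : TJump F (fun _ => 0) g := by
      intro z
      filter_upwards [H z] with u hu
      have : g u = g z := by
        by_cases hz : z ∈ TC F p
        · have h1 : h z = h p := H.const_zero (TC_preconn hp) (fun _ h => TC_zero h) hz (TC_self hp)
          have h2 : g z = 1 := if_pos (Or.inl h1)
          rw [h2]
          apply if_pos
          rw [hu, h1, TI_eq_one hz]
          split_ifs <;> simp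
        · rw [TI_eq_zero hz] at hu
          have : h u = h z := by simpa using hu
          simp only [g, this]
      simp [this]
    obtain ⟨a, ha⟩ := T_far R
    have := hg.const isPreconnected_univ (fun _ _ _ => rfl) (mem_univ p) (mem_univ a)
    simp only [g, hR a ha] at this
    by_contra! hc
    rw [if_pos (Or.inl trivial), if_neg] at this
    · exact absurd this one_ne_zero
    · rintro (h1 | h1)
      · exact hc.1 h1.symm
      · exact hc.2 (by omega)
  obtain ⟨ε, hε, hb⟩ := Metric.eventually_nhds_iff_ball.1 (TC_nhds hA hp)
  obtain ⟨y, hyb, hy0, hhy⟩ : ∃ y ∈ Metric.ball p ε, F y ≠ 0 ∧ h y = 0 := by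
    obtain ⟨N, hN, hNW, hU, hV, -⟩ := hA p hp _ (inter_mem (Metric.ball_mem_nhds p hε) (H p))
    rcases hk with hk | hk
    · obtain ⟨y, hyN, hy⟩ := hV.nonempty
      replace hy : F y < 0 := hy
      refine ⟨y, (hNW hyN).1, hy.ne, ?_⟩
      have : h y = _ := (hNW hyN).2
      rw [this, hk, if_neg (by simp [hy.le])]; simp
    · obtain ⟨y, hyN, hy⟩ := hU.nonempty
      replace hy : 0 < F y := hy
      refine ⟨y, (hNW hyN).1, hy.ne', ?_⟩
      have : h y = _ := (hNW hyN).2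
      rw [this, hk, if_pos ⟨hp, hy⟩, TI_eq_one (TC_self hp)]; simp
  refine ⟨y, hy0, fun x hx h' R' H' hR' => ?_⟩
  by_cases hpx : p ∈ TC F x
  · have e : TC F p = TC F x := pathComponentIn_congr hpx
    rw [← e] at H'
    have J := H'.add (H.smul (-1))
    obtain ⟨a, ha⟩ := T_far (max R R')
    have := J.const isPreconnected_univ (fun _ _ _ => by ring) (mem_univ y) (mem_univ a)
    simp only [hhy, hR a (lt_of_le_of_lt (le_max_left _ _) ha),
      hR' a (lt_of_le_of_lt (le_max_right _ _) ha)] at this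
    simpa using this
  · have hdisj : ∀ z ∈ TC F p, z ∉ TC F x := fun z hz hzx => hpx ((TC_mem_iff hz).1 hzx)
    have e : h' y = h' p := H'.const (convex_ball p ε).isPreconnected
      (fun z hz hz0 => TI_eq_zero (hdisj z (hb z hz hz0))) hyb (Metric.mem_ball_self hε)
    rw [e]
    by_contra hne
    have hC : IsCompact (TC F p) :=
      Metric.isCompact_of_isClosed_isBounded (TC_closed hF hA p) (TC_bdd hF hA hper hno p)
    obtain ⟨q, hq, hqm⟩ := hC.exists_isMaxOn ⟨p, TC_self hp⟩ continuous_fst.continuousOn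
    obtain ⟨q', hq', hqm'⟩ := hC.exists_isMinOn ⟨p, TC_self hp⟩ continuous_fst.continuousOn
    obtain ⟨t, ht, ht1⟩ := T_ray H' hR' hp hpx hne hq 1 (by simp)
    obtain ⟨t', ht', ht1'⟩ := T_ray H' hR' hp hpx hne hq' (-1) (by simp)
    have b1 : w p ≤ q.1 - q'.1 := by
      refine Metric.diam_le_of_forall_dist_le (sub_nonneg.2 (hqm hq')) ?_
      rintro _ ⟨a, ha, rfl⟩ _ ⟨b, hb, rfl⟩
      have h1 : a.1 ≤ q.1 := hqm ha
      have h2 : b.1 ≤ q.1 := hqm hb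
      have h3 : q'.1 ≤ a.1 := hqm' ha
      have h4 : q'.1 ≤ b.1 := hqm' hb
      rw [Real.dist_eq, abs_le]
      constructor <;> linarith
    have hbd : Bornology.IsBounded (Prod.fst '' TC F x) :=
      ((Metric.isCompact_of_isClosed_isBounded (TC_closed hF hA x)
        (TC_bdd hF hA hper hno x)).image continuous_fst).isBounded
    have b2 := Metric.dist_le_diam_of_mem hbd (mem_image_of_mem _ ht1) (mem_image_of_mem _ ht1')
    rw [Real.dist_eq] at b2
    have b3 := le_abs_self ((q + (1 * t, 0)).1 - (q' + (-1 * t', 0)).1)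
    have b4 := hmax' x hx
    simp only [Prod.fst_add, w] at b1 b2 b3 b4
    linarith

theorem T_out_add {F : ℝ × ℝ → ℝ} (hper : TPer F) {y : ℝ × ℝ} (hy : TOut F y) (v : ℤ × ℤ) :
    TOut F (y + Tvec v) := by
  intro x hx h R H hR
  have e0 : ∀ z : ℝ × ℝ, z + Tvec (-v) + Tvec v = z := fun z => by ext <;> simp
  refine hy (x + Tvec (-v)) (by rw [hper, hx]) (fun z => h (z + Tvec v)) (R + ‖Tvec v‖) ?_ ?_
  · intro z
    have hc : Tendsto (fun u : ℝ × ℝ => u + Tvec v) (𝓝 z) (𝓝 (z + Tvec v)) :=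
      (continuous_add_const (Tvec v)).tendsto z
    filter_upwards [hc.eventually (H (z + Tvec v))] with u hu
    rw [hu, hper, hper]
    have : TI (TC F (x + Tvec (-v))) z = TI (TC F x) (z + Tvec v) := by
      have := TC_add hper (x := x + Tvec (-v)) (z := z) v
      rw [e0] at this
      exact TI_congr this.symm
    rw [this]
  · intro z hz
    apply hR
    have := norm_sub_le (z + Tvec v) (Tvec v)
    rw [add_sub_cancel_right] at this
    linarith

theorem T_out_loop {F : ℝ × ℝ → ℝ} {γ : ℝ → ℝ × ℝ} {v : ℤ × ℤ} (hγ : Continuous γ)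
    (hv : ∀ t, γ (t + 1) = γ t + ((v.1 : ℝ), (v.2 : ℝ))) (hne : v ≠ 0)
    (h0 : ∀ t, F (γ t) ≠ 0) : TOut F (γ 0) := by
  intro x hx h R H hR
  have hn : ∀ n : ℕ, γ n = γ 0 + (n : ℝ) • Tvec v := by
    intro n
    induction n with
    | zero => simp
    | succ n ih =>
      push_cast
      rw [hv, ih, add_smul, one_smul, add_assoc]
  have hpos : 0 < ‖Tvec v‖ := by
    rw [norm_pos_iff]
    intro hc
    apply hne
    have h1 := congrArg Prod.fst hc
    have h2 := congrArg Prod.snd hc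
    simp only [Prod.fst_zero, Prod.snd_zero, Int.cast_eq_zero] at h1 h2
    exact Prod.ext h1 h2
  obtain ⟨n, hn'⟩ := exists_nat_gt ((R + ‖γ 0‖) / ‖Tvec v‖)
  rw [div_lt_iff₀ hpos] at hn'
  have e := H.const (isPreconnected_range hγ) (by
    rintro _ ⟨t, rfl⟩ h; exact absurd h (h0 t)) (mem_range_self 0) (mem_range_self (n : ℝ))
  rw [e]
  apply hR
  rw [hn]
  have := norm_sub_le (γ 0 + (n : ℝ) • Tvec v) (γ 0)
  rw [add_sub_cancel_left, norm_smul, Real.norm_natCast] at this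
  linarith

theorem T_extract {F : ℝ × ℝ → ℝ} (hA : TLoc F) {b : ℝ × ℝ → ℤ}
    (hb : ∀ x, ∃ s : ℤ, ∀ᶠ y in 𝓝 x, b y = b x + (if F x = 0 ∧ 0 < F y then s else 0)) :
    ∃ s, TJump F s b ∧ ContinuousOn s {x | F x = 0} := by
  choose s hs using hb
  refine ⟨s, hs, fun x hx => ?_⟩
  replace hx : F x = 0 := hx
  refine (continuousWithinAt_const (b := s x)).congr_of_eventuallyEq ?_ rfl
  filter_upwards [(eventually_eventually_nhds.2 (hs x)).filter_mono nhdsWithin_le_nhds,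
    self_mem_nhdsWithin] with y h1 h2
  replace h2 : F y = 0 := h2
  obtain ⟨N, hN, hNW, ⟨z, ⟨hzN, hz⟩, -⟩, -, -⟩ := hA y h2 _ (inter_mem h1 (hs y))
  replace hz : 0 < F z := hz
  have e1 : b z = _ := (hNW hzN).1
  have e2 : b z = _ := (hNW hzN).2
  have e3 := h1.self_of_nhds
  rw [h2] at e3
  rw [if_pos ⟨hx, hz⟩] at e1
  rw [if_pos ⟨h2, hz⟩] at e2
  simp at e3
  omega

theorem T_comp_nhds {S : Set (ℝ × ℝ)} (hS : IsOpen S) {x : ℝ × ℝ} (hx : x ∈ S) (y : ℝ × ℝ) :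
    ∀ᶠ w in 𝓝 x, (w ∈ pathComponentIn S y ↔ x ∈ pathComponentIn S y) := by
  obtain ⟨ε, hε, hb⟩ := Metric.isOpen_iff.1 hS x hx
  filter_upwards [Metric.ball_mem_nhds x hε] with w hw
  have : JoinedIn S x w := ((convex_ball x ε).isPathConnected ⟨x, Metric.mem_ball_self hε⟩).joinedIn
    x (Metric.mem_ball_self hε) w hw |>.mono hb
  exact ⟨fun h => JoinedIn.trans h this.symm, fun h => JoinedIn.trans h this⟩

theorem T_b_pos {F : ℝ × ℝ → ℝ} (hF : Continuous F) (hA : TLoc F) (y : ℝ × ℝ) (x : ℝ × ℝ) :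
    ∃ s : ℤ, ∀ᶠ w in 𝓝 x, TI (pathComponentIn {z | 0 < F z} y) w =
      TI (pathComponentIn {z | 0 < F z} y) x + (if F x = 0 ∧ 0 < F w then s else 0) := by
  set B := pathComponentIn {z | 0 < F z} y with hB
  have hBU : ∀ w ∈ B, 0 < F w := fun w hw => pathComponentIn_subset (F := {z | 0 < F z}) hw
  have hout : ∀ w, F w ≤ 0 → TI B w = 0 := fun w hw =>
    TI_eq_zero fun h => absurd (hBU w h) (not_lt.2 hw)
  rcases lt_trichotomy (F x) 0 with hx | hx | hx
  · refine ⟨0, ?_⟩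
    filter_upwards [hF.continuousAt.eventually_lt continuousAt_const hx] with w hw
    rw [hout w hw.le, hout x hx.le]; simp
  · obtain ⟨N, hN, -, hU, -, -⟩ := hA x hx univ univ_mem
    by_cases hne : ∃ z ∈ N, z ∈ B
    · obtain ⟨z, hz, hzB⟩ := hne
      refine ⟨1, ?_⟩
      filter_upwards [hN] with w hw
      rw [hout x hx.le]
      by_cases hw0 : 0 < F w
      · rw [if_pos ⟨hx, hw0⟩, TI_eq_one, zero_add]
        have := hU.subset_pathComponentIn (F := {z | 0 < F z}) (x := z) ⟨hz, hBU z hzB⟩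
          inter_subset_right ⟨hw, hw0⟩
        exact JoinedIn.trans hzB this
      · rw [if_neg (fun h => hw0 h.2), hout w (not_lt.1 hw0)]; simp
    · push Not at hne
      refine ⟨0, ?_⟩
      filter_upwards [hN] with w hw
      rw [hout x hx.le, TI_eq_zero (hne w hw)]; simp
  · refine ⟨0, ?_⟩
    filter_upwards [T_comp_nhds (isOpen_lt continuous_const hF) hx y] with w hw
    have e : TI B w = TI B x := TI_congr hw
    rw [e]; simp

theorem T_neg_closure {F : ℝ × ℝ → ℝ} (hF : Continuous F) (y : ℝ × ℝ) {w : ℝ × ℝ} (hw : F w < 0) :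
    w ∈ closure (pathComponentIn {z | F z < 0} y) ↔ w ∈ pathComponentIn {z | F z < 0} y := by
  refine ⟨fun h => ?_, fun h => subset_closure h⟩
  obtain ⟨z, hz, hzB⟩ := mem_closure_iff_nhds.1 h _
    (T_comp_nhds (isOpen_lt hF continuous_const) hw y)
  exact hz.1 hzB

theorem T_b_neg {F : ℝ × ℝ → ℝ} (hF : Continuous F) (hA : TLoc F) (y : ℝ × ℝ) (x : ℝ × ℝ) :
    ∃ s : ℤ, ∀ᶠ w in 𝓝 x, TI (closure (pathComponentIn {z | F z < 0} y)) w =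
      TI (closure (pathComponentIn {z | F z < 0} y)) x +
        (if F x = 0 ∧ 0 < F w then s else 0) := by
  have hnc : ∀ {w}, F w < 0 → _ := fun {w} hw => T_neg_closure hF y hw
  set B := pathComponentIn {z | F z < 0} y with hB
  have hBV : ∀ w ∈ B, F w < 0 := fun w hw => pathComponentIn_subset (F := {z | F z < 0}) hw
  have hcl : ∀ w ∈ closure B, F w ≤ 0 := fun w hw =>
    closure_minimal (t := {z | F z ≤ 0}) (fun z hz => (hBV z hz).le)
      (isClosed_le hF continuous_const) hw
  have hout : ∀ w, 0 < F w → TI (closure B) w = 0 := fun w hw =>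
    TI_eq_zero fun h => absurd (hcl w h) (not_le.2 hw)
  rcases lt_trichotomy (F x) 0 with hx | hx | hx
  · refine ⟨0, ?_⟩
    filter_upwards [T_comp_nhds (isOpen_lt hF continuous_const) hx y,
      hF.continuousAt.eventually_lt continuousAt_const hx] with w hw hw0
    rw [TI_congr ((hnc hw0).trans (hw.trans (hnc hx).symm))]; simp
  · obtain ⟨N, hN, -, -, hV, -⟩ := hA x hx univ univ_mem
    by_cases hne : ∃ z ∈ N, z ∈ B
    · obtain ⟨z, hz, hzB⟩ := hne
      have hNB : ∀ w ∈ N, F w < 0 → w ∈ B := fun w hw hw0 => by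
        have := hV.subset_pathComponentIn (F := {z | F z < 0}) (x := z) ⟨hz, hBV z hzB⟩
          inter_subset_right ⟨hw, hw0⟩
        exact JoinedIn.trans hzB this
      have hNB' : ∀ w, N ∈ 𝓝 w → F w ≤ 0 → w ∈ closure B := fun w hw hw0 => by
        rcases hw0.lt_or_eq with h | h
        · exact subset_closure (hNB w (mem_of_mem_nhds hw) h)
        · refine mem_closure_iff_nhds.2 fun W hW => ?_
          obtain ⟨N', -, hN'W, -, hV', -⟩ := hA w h _ (inter_mem hW hw)
          obtain ⟨u, hu, hu0⟩ := hV'.nonempty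
          exact ⟨u, (hN'W hu).1, hNB u (hN'W hu).2 hu0⟩
      refine ⟨-1, ?_⟩
      filter_upwards [eventually_mem_nhds_iff.2 hN] with w hw
      rw [TI_eq_one (hNB' x hN hx.le)]
      by_cases hw0 : 0 < F w
      · rw [if_pos ⟨hx, hw0⟩, hout w hw0]; simp
      · rw [if_neg (fun h => hw0 h.2), TI_eq_one (hNB' w hw (not_lt.1 hw0))]; simp
    · push Not at hne
      have hNB' : ∀ w, N ∈ 𝓝 w → w ∉ closure B := fun w hw hc => by
        obtain ⟨u, hu, huB⟩ := mem_closure_iff_nhds.1 hc N hw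
        exact hne u hu huB
      refine ⟨0, ?_⟩
      filter_upwards [eventually_mem_nhds_iff.2 hN] with w hw
      rw [TI_eq_zero (hNB' w hw), TI_eq_zero (hNB' x hN)]; simp
  · refine ⟨0, ?_⟩
    filter_upwards [continuousAt_const.eventually_lt hF.continuousAt hx] with w hw
    rw [hout w hw, hout x hx]; simp

theorem T_sign {F : ℝ × ℝ → ℝ} (hF : Continuous F) (hA : TLoc F) (hper : TPer F) (hno : TNo F)
    {y y' : ℝ × ℝ} (hy : TOut F y) (hy' : TOut F y') (h : 0 < F y) (h' : F y' < 0) : False := by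
  have H : TJump F (fun _ => 1) (TI {z | 0 < F z}) := by
    intro x
    rcases lt_trichotomy (F x) 0 with hx | hx | hx
    · filter_upwards [hF.continuousAt.eventually_lt continuousAt_const hx] with w hw
      simp [TI, not_lt.2 hx.le, not_lt.2 hw.le, hx.ne]
    · filter_upwards with w
      simp [TI, hx]
    · filter_upwards [continuousAt_const.eventually_lt hF.continuousAt hx] with w hw
      simp [TI, hx, hw, hx.ne']
  have := T_K hF hA hper hno H continuousOn_const hy hy'
  rw [TI_eq_one h, TI_eq_zero (by exact not_lt.2 h'.le)] at this
  exact one_ne_zero this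

end THelpers

/-- Let `F : ℝ² → ℝ` be smooth and `ℤ²`-periodic (a smooth function on `T²`) with `0` a regular
value, and suppose every loop contained in `F⁻¹(0)` is contractible. Then one of the
inclusion-induced images in `H₁(T²) ≅ ℤ²` of `{F > 0}` and `{F < 0}` is all of `ℤ²`
while the other is zero. -/
theorem stmt_7 (F : ℝ × ℝ → ℝ) (hF : ContDiff ℝ (⊤ : ℕ∞) F)
    (hper : ∀ (x : ℝ × ℝ) (m : ℤ × ℤ), F (x + ((m.1 : ℝ), (m.2 : ℝ))) = F x)
    (hreg : ∀ x, F x = 0 → fderiv ℝ F x ≠ 0)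
    (hcontr : ∀ (γ : ℝ → ℝ × ℝ) (v : ℤ × ℤ), Continuous γ →
      (∀ t, γ (t + 1) = γ t + ((v.1 : ℝ), (v.2 : ℝ))) → (∀ t, F (γ t) = 0) → v = 0) :
    (loopClasses F (fun a => 0 < a) = ⊤ ∧ loopClasses F (fun a => a < 0) = ⊥) ∨
    (loopClasses F (fun a => a < 0) = ⊤ ∧ loopClasses F (fun a => 0 < a) = ⊥) := by
  have hFc : Continuous F := hF.continuous
  have hA : TLoc F := fun x hx W hW => T_local hF hx (hreg x hx) hW
  have hp : TPer F := hper
  have hno : TNo F := by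
    intro x v h
    obtain ⟨γ, h1, h2, h3⟩ := T_loop hp (fun a => a = 0) h
    exact hcontr γ v h1 h2 h3
  obtain ⟨y, hy0, hy⟩ := T_out_exists hFc hA hp hno
  rcases lt_or_gt_of_ne hy0 with hneg | hpos
  · right
    constructor
    · rw [eq_top_iff]
      intro v _
      apply AddSubgroup.subset_closure
      obtain ⟨s, hs, hsc⟩ := T_extract hA (T_b_neg hFc hA y)
      have e := T_K hFc hA hp hno hs hsc hy (T_out_add hp hy v)
      have hyB : y ∈ pathComponentIn {z | F z < 0} y := mem_pathComponentIn_self hneg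
      rw [TI_eq_one (subset_closure hyB)] at e
      have hv : y + Tvec v ∈ closure (pathComponentIn {z | F z < 0} y) := by
        by_contra hc
        rw [TI_eq_zero hc] at e
        exact one_ne_zero e
      rw [T_neg_closure hFc y (by rw [hp]; exact hneg)] at hv
      exact T_loop hp (fun a => a < 0) hv
    · rw [eq_bot_iff]
      refine (AddSubgroup.closure_le _).2 ?_
      rintro v ⟨γ, h1, h2, h3⟩
      by_contra hne
      exact T_sign hFc hA hp hno (T_out_loop h1 h2 hne (fun t => (h3 t).ne')) hy (h3 0) hneg
  · left
    constructor
    · rw [eq_top_iff]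
      intro v _
      apply AddSubgroup.subset_closure
      obtain ⟨s, hs, hsc⟩ := T_extract hA (T_b_pos hFc hA y)
      have e := T_K hFc hA hp hno hs hsc hy (T_out_add hp hy v)
      have hyB : y ∈ pathComponentIn {z | 0 < F z} y := mem_pathComponentIn_self hpos
      rw [TI_eq_one hyB] at e
      have hv : y + Tvec v ∈ pathComponentIn {z | 0 < F z} y := by
        by_contra hc
        rw [TI_eq_zero hc] at e
        exact one_ne_zero e
      exact T_loop hp (fun a => 0 < a) hv
    · rw [eq_bot_iff]
      refine (AddSubgroup.closure_le _).2 ?_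
      rintro v ⟨γ, h1, h2, h3⟩
      by_contra hne
      exact T_sign hFc hA hp hno hy (T_out_loop h1 h2 hne (fun t => (h3 t).ne)) hpos (h3 0)
end

section
/- Let f : T² → ℝ be a smooth function on the 2-torus with no critical points at height 0. Then there exists a smooth loop γ : S¹ → T² ∖ f⁻¹(0) that is non-contractible in T². -/
open Set Filter Topology


def Per (G : ℝ × ℝ → ℝ) : Prop := ∀ (x : ℝ × ℝ) (m : ℤ × ℤ), G (x + ((m.1 : ℝ), (m.2 : ℝ))) = G x

theorem per_fderiv {G : ℝ × ℝ → ℝ} (h : Per G) (x : ℝ × ℝ) (m : ℤ × ℤ) :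
    fderiv ℝ G (x + ((m.1 : ℝ), (m.2 : ℝ))) = fderiv ℝ G x := by
  rw [← fderiv_comp_add_right]
  congr 1
  funext y
  exact h y m

theorem no_div {A B : ℝ × ℝ → ℝ} (hA : ContDiff ℝ 1 A) (hB : ContDiff ℝ 1 B)
    (pA : Per A) (pB : Per B)
    (h : ∀ x, 1 + (fderiv ℝ A x (1, 0) + fderiv ℝ B x (0, 1)) = 0) : False := by
  have key := MeasureTheory.integral2_divergence_prod_of_hasFDerivAt A B (fderiv ℝ A) (fderiv ℝ B)
    0 0 1 1 hA.continuous.continuousOn hB.continuous.continuousOn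
    (fun x _ => (hA.differentiable one_ne_zero x).hasFDerivAt)
    (fun x _ => (hB.differentiable one_ne_zero x).hasFDerivAt)
    (by
      have : (fun x => fderiv ℝ A x (1, 0) + fderiv ℝ B x (0, 1)) = fun _ => (-1 : ℝ) := by
        funext x; linarith [h x]
      rw [this]
      apply ContinuousOn.integrableOn_compact
      · exact isCompact_uIcc.prod isCompact_uIcc
      · exact continuousOn_const)
  have e : ∀ x y : ℝ, fderiv ℝ A (x, y) (1, 0) + fderiv ℝ B (x, y) (0, 1) = -1 := by
    intro x y; linarith [h (x, y)]
  have e1 : ∀ x : ℝ, B (x, 1) = B (x, 0) := by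
    intro x; have := pB (x, 0) (0, 1); simpa using this
  have e2 : ∀ y : ℝ, A (1, y) = A (0, y) := by
    intro x; have := pA (0, x) (1, 0); simpa using this
  simp [e, e1, e2] at key

theorem no_pq {p q : ℝ × ℝ → ℝ} (hp : ContDiff ℝ (⊤ : ℕ∞) p) (hq : ContDiff ℝ (⊤ : ℕ∞) q)
    (pp : Per p) (pq : Per q)
    (h : ∀ x, (1 + fderiv ℝ p x (1, 0)) * (1 + fderiv ℝ q x (0, 1))
      - fderiv ℝ p x (0, 1) * fderiv ℝ q x (1, 0) = 0) : False := by
  have hq' : ContDiff ℝ 1 (fderiv ℝ q) := hq.fderiv_right (by norm_cast)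
  have hp1 : ContDiff ℝ 1 p := hp.of_le (by norm_cast)
  have hq1 : ContDiff ℝ 1 q := hq.of_le (by norm_cast)
  have hqv : ∀ v : ℝ × ℝ, ContDiff ℝ 1 (fun x => fderiv ℝ q x v) :=
    fun v => hq'.clm_apply contDiff_const
  have dqv : ∀ v w x : ℝ × ℝ, fderiv ℝ (fun x => fderiv ℝ q x v) x w
      = fderiv ℝ (fderiv ℝ q) x w v := by
    intro v w x
    have := ((hq'.differentiable one_ne_zero x).hasFDerivAt.clm_apply (hasFDerivAt_const v x)).fderiv
    rw [this]; simp
  refine no_div (A := fun x => p x + p x * fderiv ℝ q x (0, 1))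
    (B := fun x => q x - p x * fderiv ℝ q x (1, 0)) ?_ ?_ ?_ ?_ ?_
  · exact hp1.add (hp1.mul (hqv _))
  · exact hq1.sub (hp1.mul (hqv _))
  · intro x m; simp only [pp x m, per_fderiv pq x m]
  · intro x m; simp only [pp x m, pq x m, per_fderiv pq x m]
  · intro x
    have dp := (hp1.differentiable one_ne_zero x).hasFDerivAt
    have dq := (hq1.differentiable one_ne_zero x).hasFDerivAt
    have d := fun v => ((hqv v).differentiable one_ne_zero x).hasFDerivAt
    have hA := (dp.add (dp.mul (d (0, 1)))).fderiv
    have hB := (dq.sub (dp.mul (d (1, 0)))).fderiv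
    have hA' : fderiv ℝ (fun x => p x + p x * fderiv ℝ q x (0, 1)) x = _ := hA
    have hB' : fderiv ℝ (fun x => q x - p x * fderiv ℝ q x (1, 0)) x = _ := hB
    rw [hA', hB']
    have sym : fderiv ℝ (fderiv ℝ q) x (1, 0) (0, 1) = fderiv ℝ (fderiv ℝ q) x (0, 1) (1, 0) := by
      have := (hq.contDiffAt (x := x)).isSymmSndFDerivAt (by simp; norm_cast)
      exact this _ _
    simp only [add_apply, sub_apply, smul_apply,
      smul_eq_mul, dqv, sym]
    linarith [h x]

/-- reduce to the unit square -/
theorem red (x : ℝ × ℝ) : ∃ m : ℤ × ℤ, x + ((m.1 : ℝ), (m.2 : ℝ)) ∈ Icc (0 : ℝ) 1 ×ˢ Icc (0 : ℝ) 1 := by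
  refine ⟨(-⌊x.1⌋, -⌊x.2⌋), ?_⟩
  have h1 := Int.floor_le x.1
  have h2 := Int.lt_floor_add_one x.1
  have h3 := Int.floor_le x.2
  have h4 := Int.lt_floor_add_one x.2
  simp only [mem_prod, mem_Icc, Prod.fst_add, Prod.snd_add, Int.cast_neg]
  refine ⟨⟨?_, ?_⟩, ?_, ?_⟩ <;> linarith

noncomputable def gr (G : ℝ × ℝ → ℝ) (x : ℝ × ℝ) : ℝ × ℝ := (fderiv ℝ G x (1, 0), fderiv ℝ G x (0, 1))

theorem gr_pos {G : ℝ × ℝ → ℝ} {x : ℝ × ℝ} (h : fderiv ℝ G x ≠ 0) :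
    0 < fderiv ℝ G x (gr G x) := by
  have e : ∀ v : ℝ × ℝ, fderiv ℝ G x v = v.1 * fderiv ℝ G x (1, 0) + v.2 * fderiv ℝ G x (0, 1) := by
    intro v
    have : v = v.1 • (1, 0) + v.2 • ((0, 1) : ℝ × ℝ) := by ext <;> simp
    conv_lhs => rw [this]
    rw [map_add, map_smul, map_smul]; rfl
  rw [e]
  simp only [gr]
  by_contra hc
  have h1 : fderiv ℝ G x (1, 0) = 0 := by
    nlinarith [mul_self_nonneg (fderiv ℝ G x (1, 0)), mul_self_nonneg (fderiv ℝ G x (0, 1))]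
  have h2 : fderiv ℝ G x (0, 1) = 0 := by
    nlinarith [mul_self_nonneg (fderiv ℝ G x (1, 0)), mul_self_nonneg (fderiv ℝ G x (0, 1))]
  apply h
  apply ContinuousLinearMap.ext
  intro v; rw [e, h1, h2]; simp

theorem gr_smooth {G : ℝ × ℝ → ℝ} (hG : ContDiff ℝ (⊤ : ℕ∞) G) : ContDiff ℝ (⊤ : ℕ∞) (gr G) := by
  have h : ContDiff ℝ (⊤ : ℕ∞) (fderiv ℝ G) := hG.fderiv_right (by norm_cast)
  exact (h.clm_apply contDiff_const).prodMk (h.clm_apply contDiff_const)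

theorem push {G : ℝ × ℝ → ℝ} (hG : ContDiff ℝ (⊤ : ℕ∞) G) (pG : Per G)
    (hreg : ∀ x, G x = 0 → fderiv ℝ G x ≠ 0) :
    ∃ s : ℝ, ∀ x, 0 ≤ G x → 0 < G (x + s • gr G x) := by
  have cG := hG.continuous
  have cg := (gr_smooth hG).continuous
  have cd : Continuous (fderiv ℝ G) := hG.continuous_fderiv (by simp)
  have K : IsCompact (Icc (0 : ℝ) 1 ×ˢ Icc (0 : ℝ) 1) := isCompact_Icc.prod isCompact_Icc
  have ev : ∀ᶠ s : ℝ in 𝓝 0, ∀ y ∈ Icc (0 : ℝ) 1 ×ˢ Icc (0 : ℝ) 1,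
      (0 < s → 0 ≤ G y → 0 < G (y + s • gr G y)) := by
    apply K.eventually_forall_of_forall_eventually
    intro x _
    rcases lt_trichotomy (G x) 0 with h | h | h
    · have : ∀ᶠ z : ℝ × (ℝ × ℝ) in 𝓝 (0, x), G z.2 < 0 :=
        (cG.comp continuous_snd).continuousAt.eventually_lt continuousAt_const h
      filter_upwards [this] with z hz _ h0
      linarith
    · have c : Continuous fun z : ℝ × (ℝ × ℝ) => fderiv ℝ G (z.2 + z.1 • gr G z.2) (gr G z.2) := by
        fun_prop
      have : ∀ᶠ z : ℝ × (ℝ × ℝ) in 𝓝 (0, x), 0 < fderiv ℝ G (z.2 + z.1 • gr G z.2) (gr G z.2) := by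
        apply continuousAt_const.eventually_lt c.continuousAt
        simpa using gr_pos (hreg x h)
      obtain ⟨ε, he, hb⟩ := Metric.eventually_nhds_iff_ball.1 this
      filter_upwards [Metric.ball_mem_nhds _ he] with z hz hs h0
      have hd : ∀ t : ℝ, HasDerivAt (fun t : ℝ => G (z.2 + t • gr G z.2))
          (fderiv ℝ G (z.2 + t • gr G z.2) (gr G z.2)) t := by
        intro t
        have h1 : HasDerivAt (fun t : ℝ => z.2 + t • gr G z.2) (gr G z.2) t := by
          simpa using ((hasDerivAt_id t).smul_const (gr G z.2)).const_add z.2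
        exact ((hG.differentiable (by simp) _).hasFDerivAt).comp_hasDerivAt t h1
      have mono : StrictMonoOn (fun t : ℝ => G (z.2 + t • gr G z.2)) (Icc 0 z.1) := by
        apply strictMonoOn_of_deriv_pos (convex_Icc _ _)
        · exact fun t _ => (hd t).continuousAt.continuousWithinAt
        · intro t ht
          rw [interior_Icc] at ht
          rw [(hd t).deriv]
          refine hb (t, z.2) ?_
          rw [Metric.mem_ball, Prod.dist_eq, max_lt_iff] at hz ⊢
          refine ⟨?_, hz.2⟩
          have := hz.1
          simp only [Real.dist_eq, sub_zero] at this ⊢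
          rw [abs_of_pos ht.1]; rw [abs_of_pos hs] at this
          exact ht.2.trans this
      have := mono (left_mem_Icc.2 hs.le) (right_mem_Icc.2 hs.le) hs
      simp only [zero_smul, add_zero] at this
      linarith
    · have c : Continuous fun z : ℝ × (ℝ × ℝ) => G (z.2 + z.1 • gr G z.2) := by fun_prop
      have : ∀ᶠ z : ℝ × (ℝ × ℝ) in 𝓝 (0, x), 0 < G (z.2 + z.1 • gr G z.2) := by
        apply continuousAt_const.eventually_lt c.continuousAt
        simpa using h
      filter_upwards [this] with z hz _ _
      exact hz
  obtain ⟨ε, he, hb⟩ := Metric.eventually_nhds_iff_ball.1 ev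
  refine ⟨ε / 2, fun x hx => ?_⟩
  obtain ⟨m, hm⟩ := red x
  have := hb (ε / 2) (by rw [Metric.mem_ball, Real.dist_eq, sub_zero, abs_of_pos] <;> linarith) _ hm
    (by linarith) (by rw [pG]; exact hx)
  have e : gr G (x + ((m.1 : ℝ), (m.2 : ℝ))) = gr G x := by simp only [gr, per_fderiv pG]
  rwa [e, add_right_comm, pG] at this
def RR (G : ℝ × ℝ → ℝ) (x y : ℝ × ℝ) : Prop :=
  ∃ γ : ℝ → ℝ × ℝ, ContDiff ℝ (⊤ : ℕ∞) γ ∧ (∀ t ≤ 0, γ t = x) ∧ (∀ t, 1 ≤ t → γ t = y) ∧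
    ∀ t, 0 < G (γ t)

theorem RR.symm {G : ℝ × ℝ → ℝ} {x y : ℝ × ℝ} (h : RR G x y) : RR G y x := by
  obtain ⟨γ, h1, h2, h3, h4⟩ := h
  refine ⟨fun t => γ (1 - t), h1.comp (contDiff_const.sub contDiff_id), fun t ht => h3 _ (by linarith),
    fun t ht => h2 _ (by linarith), fun t => h4 _⟩

theorem RR.trans {G : ℝ × ℝ → ℝ} {x y z : ℝ × ℝ} (h : RR G x y) (h' : RR G y z) : RR G x z := by
  obtain ⟨γ, h1, h2, h3, h4⟩ := h
  obtain ⟨δ, k1, k2, k3, k4⟩ := h'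
  refine ⟨fun t => γ (2 * t) + δ (2 * t - 1) - y, ?_, ?_, ?_, ?_⟩
  · exact ((h1.comp (contDiff_const.mul contDiff_id)).add
      (k1.comp ((contDiff_const.mul contDiff_id).sub contDiff_const))).sub contDiff_const
  · intro t ht
    simp only [h2 (2 * t) (by linarith), k2 (2 * t - 1) (by linarith), add_sub_cancel_right]
  · intro t ht
    simp only [h3 (2 * t) (by linarith), k3 (2 * t - 1) (by linarith), add_sub_cancel_left]
  · intro t
    rcases le_total t (1 / 2) with ht | ht
    · simp only [k2 (2 * t - 1) (by linarith), add_sub_cancel_right]; exact h4 _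
    · simp only [h3 (2 * t) (by linarith), add_sub_cancel_left]; exact k4 _

theorem RR.translate {G : ℝ × ℝ → ℝ} (pG : Per G) {x y : ℝ × ℝ} (h : RR G x y) (k : ℤ × ℤ) :
    RR G (x + ((k.1 : ℝ), (k.2 : ℝ))) (y + ((k.1 : ℝ), (k.2 : ℝ))) := by
  obtain ⟨γ, h1, h2, h3, h4⟩ := h
  refine ⟨fun t => γ t + ((k.1 : ℝ), (k.2 : ℝ)), h1.add contDiff_const, fun t ht => ?_,
    fun t ht => ?_, fun t => ?_⟩
  · simp only [h2 t ht]
  · simp only [h3 t ht]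
  · simp only [pG _ k]; exact h4 t

theorem RR.near {G : ℝ × ℝ → ℝ} (cG : Continuous G) {x : ℝ × ℝ} (h : 0 < G x) :
    ∀ᶠ y in 𝓝 x, RR G x y := by
  have : ∀ᶠ y in 𝓝 x, 0 < G y := continuousAt_const.eventually_lt cG.continuousAt h
  obtain ⟨ε, he, hb⟩ := Metric.eventually_nhds_iff_ball.1 this
  filter_upwards [Metric.ball_mem_nhds _ he] with y hy
  refine ⟨fun t => x + Real.smoothTransition t • (y - x), ?_, ?_, ?_, ?_⟩
  · exact contDiff_const.add (Real.smoothTransition.contDiff.smul contDiff_const)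
  · intro t ht; simp [Real.smoothTransition.zero_of_nonpos ht]
  · intro t ht; simp [Real.smoothTransition.one_of_one_le ht]
  · intro t
    apply hb
    apply (convex_ball x ε).add_smul_sub_mem (Metric.mem_ball_self he) hy
    exact ⟨Real.smoothTransition.nonneg t, Real.smoothTransition.le_one t⟩

theorem RR.refl {G : ℝ × ℝ → ℝ} {x : ℝ × ℝ} (h : 0 < G x) : RR G x x :=
  ⟨fun _ => x, contDiff_const, fun _ _ => rfl, fun _ _ => rfl, fun _ => h⟩

theorem RR.loop {G : ℝ × ℝ → ℝ} (pG : Per G) {x : ℝ × ℝ} {v : ℤ × ℤ}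
    (h : RR G x (x + ((v.1 : ℝ), (v.2 : ℝ)))) :
    ∃ γ : ℝ → ℝ × ℝ, ContDiff ℝ (⊤ : ℕ∞) γ ∧ (∀ t, γ (t + 1) = γ t + ((v.1 : ℝ), (v.2 : ℝ))) ∧
      ∀ t, 0 < G (γ t) := by
  obtain ⟨γ, h1, h2, h3, h4⟩ := h
  set w : ℝ × ℝ := ((v.1 : ℝ), (v.2 : ℝ)) with hw
  refine ⟨fun t => γ (Int.fract t) + (⌊t⌋ : ℝ) • w, ?_, ?_, ?_⟩
  · rw [contDiff_iff_contDiffAt]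
    intro t
    obtain ⟨n, hn1, hn2⟩ : ∃ n : ℤ, (n : ℝ) - 1 < t ∧ t < n + 1 := by
      refine ⟨⌊t⌋, ?_, Int.lt_floor_add_one t⟩
      linarith [Int.floor_le t]
    have sm : ContDiff ℝ (⊤ : ℕ∞)
        (fun t : ℝ => γ (t - (n - 1)) + γ (t - n) - x + ((n : ℝ) - 1) • w) :=
      (((h1.comp (contDiff_id.sub contDiff_const)).add
        (h1.comp (contDiff_id.sub contDiff_const))).sub contDiff_const).add contDiff_const
    refine sm.contDiffAt.congr_of_eventuallyEq ?_
    filter_upwards [Ioo_mem_nhds hn1 hn2] with s hs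
    rcases lt_or_ge s n with hsn | hsn
    · have fl : ⌊s⌋ = n - 1 := by
        rw [Int.floor_eq_iff]; push_cast; exact ⟨hs.1.le, by linarith⟩
      rw [Int.fract, fl, h2 (s - n) (by linarith)]
      push_cast
      abel
    · have fl : ⌊s⌋ = n := by
        rw [Int.floor_eq_iff]; exact ⟨hsn, hs.2⟩
      rw [Int.fract, fl, h3 (s - (n - 1)) (by linarith), sub_smul, one_smul]
      abel
  · intro t
    simp only [Int.fract_add_one, Int.floor_add_one]
    push_cast
    rw [add_smul, one_smul]
    abel
  · intro t
    have : (⌊t⌋ : ℝ) • w = (((⌊t⌋ * v.1 : ℤ) : ℝ), ((⌊t⌋ * v.2 : ℤ) : ℝ)) := by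
      rw [hw]; ext <;> simp
    simp only [this]
    have := pG (γ (Int.fract t)) (⌊t⌋ * v.1, ⌊t⌋ * v.2)
    simp only at this
    rw [this]; exact h4 _

theorem label {G : ℝ × ℝ → ℝ} (cG : Continuous G) (pG : Per G)
    (hno : ∀ x (v : ℤ × ℤ), RR G x (x + ((v.1 : ℝ), (v.2 : ℝ))) → v = 0) :
    ∃ a : ℝ × ℝ → ℤ × ℤ, (∀ x k, 0 < G x → a (x + (((k : ℤ × ℤ).1 : ℝ), (k.2 : ℝ))) = a x + k) ∧
      ∀ x, 0 < G x → ∀ᶠ y in 𝓝 x, a y = a x := by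
  classical
  let S : ℝ × ℝ → ℝ × ℝ → Prop := fun x y => ∃ k : ℤ × ℤ, RR G x (y + ((k.1 : ℝ), (k.2 : ℝ)))
  let r : ℝ × ℝ → ℝ × ℝ := fun x => Classical.epsilon (S x)
  let a : ℝ × ℝ → ℤ × ℤ := fun x => Classical.epsilon (fun k => RR G x (r x + ((k.1 : ℝ), (k.2 : ℝ))))
  have hS : ∀ x, 0 < G x → S x (r x) := by
    intro x hx
    exact Classical.epsilon_spec (p := S x) ⟨x, 0, by convert RR.refl hx using 1; ext <;> simp⟩
  have ha : ∀ x, 0 < G x → RR G x (r x + (((a x).1 : ℝ), ((a x).2 : ℝ))) := by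
    intro x hx
    exact Classical.epsilon_spec (p := fun k : ℤ × ℤ => RR G x (r x + ((k.1 : ℝ), (k.2 : ℝ)))) (hS x hx)
  have uniq : ∀ x z (k l : ℤ × ℤ), RR G x (z + ((k.1 : ℝ), (k.2 : ℝ))) →
      RR G x (z + ((l.1 : ℝ), (l.2 : ℝ))) → l = k := by
    intro x z k l h1 h2
    have h3 := h1.symm.trans h2
    have := hno (z + ((k.1 : ℝ), (k.2 : ℝ))) (l - k) (by
      convert h3 using 1
      ext <;> simp)
    exact sub_eq_zero.1 this
  refine ⟨a, ?_, ?_⟩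
  · intro x k hx
    have hx' : 0 < G (x + ((k.1 : ℝ), (k.2 : ℝ))) := by rw [pG]; exact hx
    have er : r (x + ((k.1 : ℝ), (k.2 : ℝ))) = r x := by
      have : S (x + ((k.1 : ℝ), (k.2 : ℝ))) = S x := by
        funext y
        apply propext
        constructor
        · rintro ⟨l, hl⟩
          refine ⟨l - k, ?_⟩
          have := hl.translate pG (-k)
          convert this using 1 <;> ext <;> simp <;> ring
        · rintro ⟨l, hl⟩
          refine ⟨l + k, ?_⟩
          have := hl.translate pG k
          convert this using 1
          ext <;> simp <;> ring
      simp only [r, this]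
    have h1 := ha _ hx'
    rw [er] at h1
    refine uniq _ _ _ _ ?_ h1
    have := (ha x hx).translate pG k
    convert this using 1
    ext <;> simp <;> ring
  · intro x hx
    filter_upwards [RR.near cG hx] with y hy
    have hS' : S y = S x := by
      funext z
      apply propext
      exact ⟨fun ⟨l, hl⟩ => ⟨l, hy.trans hl⟩, fun ⟨l, hl⟩ => ⟨l, hy.symm.trans hl⟩⟩
    have er : r y = r x := by simp only [r, hS']
    have hG : 0 < G y := by
      obtain ⟨γ, _, _, h3, h4⟩ := hy
      rw [← h3 1 le_rfl]; exact h4 1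
    have h1 := ha y hG
    rw [er] at h1
    exact uniq x _ _ _ (ha x hx) (hy.trans h1)

theorem lift_label {G : ℝ × ℝ → ℝ} (hG : ContDiff ℝ (⊤ : ℕ∞) G) (pG : Per G)
    (hreg : ∀ x, G x = 0 → fderiv ℝ G x ≠ 0)
    (hno : ∀ x (v : ℤ × ℤ), RR G x (x + ((v.1 : ℝ), (v.2 : ℝ))) → v = 0) :
    ∃ (u : ℝ × ℝ → ℝ) (a : ℝ × ℝ → ℤ × ℤ), ContDiff ℝ (⊤ : ℕ∞) u ∧ Per u ∧
      (∀ x, 0 ≤ G x → 0 < u x) ∧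
      (∀ x k, 0 < u x → a (x + (((k : ℤ × ℤ).1 : ℝ), (k.2 : ℝ))) = a x + k) ∧
      ∀ x, 0 < u x → ∀ᶠ y in 𝓝 x, a y = a x := by
  obtain ⟨s, hs⟩ := push hG pG hreg
  obtain ⟨a, ha1, ha2⟩ := label hG.continuous pG hno
  have sP : ContDiff ℝ (⊤ : ℕ∞) (fun x => x + s • gr G x) :=
    contDiff_id.add ((gr_smooth hG).const_smul s)
  have eP : ∀ (x : ℝ × ℝ) (k : ℤ × ℤ), (x + ((k.1 : ℝ), (k.2 : ℝ))) +
      s • gr G (x + ((k.1 : ℝ), (k.2 : ℝ))) = (x + s • gr G x) + ((k.1 : ℝ), (k.2 : ℝ)) := by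
    intro x k
    have e : gr G (x + ((k.1 : ℝ), (k.2 : ℝ))) = gr G x := by simp only [gr, per_fderiv pG]
    rw [e, add_right_comm]
  refine ⟨fun x => G (x + s • gr G x), fun x => a (x + s • gr G x), hG.comp sP, ?_, hs, ?_, ?_⟩
  · intro x k
    simp only [eP, pG _ k]
  · intro x k hx
    simp only [eP]
    exact ha1 _ k hx
  · intro x hx
    exact sP.continuous.continuousAt.eventually (ha2 _ hx)

theorem bump {u b : ℝ × ℝ → ℝ} (l : ℝ × ℝ →L[ℝ] ℝ) (hu : ContDiff ℝ (⊤ : ℕ∞) u) (pu : Per u)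
    (hb : ∀ x (k : ℤ × ℤ), 0 < u x →
      b (x + ((k.1 : ℝ), (k.2 : ℝ))) = b x + l ((k.1 : ℝ), (k.2 : ℝ)))
    (hc : ∀ x, 0 < u x → ∀ᶠ y in 𝓝 x, b y = b x) {c : ℝ} (c0 : 0 < c) :
    ∃ p : ℝ × ℝ → ℝ, ContDiff ℝ (⊤ : ℕ∞) p ∧ Per p ∧ ∀ x, 2 * c < u x → fderiv ℝ p x = -l := by
  have z : ∀ x, u x ≤ c → Real.smoothTransition (u x / c - 1) = 0 := by
    intro x hx
    apply Real.smoothTransition.zero_of_nonpos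
    rw [sub_nonpos, div_le_one c0]; exact hx
  have o : ∀ x, 2 * c ≤ u x → Real.smoothTransition (u x / c - 1) = 1 := by
    intro x hx
    apply Real.smoothTransition.one_of_one_le
    rw [le_sub_iff_add_le, le_div_iff₀ c0]; linarith
  refine ⟨fun x => Real.smoothTransition (u x / c - 1) * (b x - l x), ?_, ?_, ?_⟩
  · rw [contDiff_iff_contDiffAt]
    intro x
    rcases lt_or_ge (u x) c with h | h
    · have : ∀ᶠ y in 𝓝 x, u y < c := hu.continuous.continuousAt.eventually_lt continuousAt_const h
      refine (contDiffAt_const (c := (0 : ℝ))).congr_of_eventuallyEq ?_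
      filter_upwards [this] with y hy
      rw [z y hy.le, zero_mul]
    · have sm : ContDiff ℝ (⊤ : ℕ∞) (fun y => Real.smoothTransition (u y / c - 1) * (b x - l y)) :=
        (Real.smoothTransition.contDiff.comp ((hu.div_const c).sub contDiff_const)).mul
          (contDiff_const.sub l.contDiff)
      refine sm.contDiffAt.congr_of_eventuallyEq ?_
      filter_upwards [hc x (by linarith)] with y hy
      rw [hy]
  · intro x k
    simp only [pu x k]
    rcases le_or_gt (u x) c with h | h
    · rw [z x h]; simp
    · rw [hb x k (by linarith), map_add]; ring
  · intro x hx
    have h1 : ∀ᶠ y in 𝓝 x, 2 * c < u y := continuousAt_const.eventually_lt hu.continuous.continuousAt hx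
    have : HasFDerivAt (fun y => b x - l y) (-l) x := by
      simpa using l.hasFDerivAt.const_sub (b x)
    rw [← this.fderiv]
    apply Filter.EventuallyEq.fderiv_eq
    filter_upwards [h1, hc x (by linarith)] with y hy hy'
    rw [o y hy.le, hy', one_mul]

theorem stmt_8 (F : ℝ × ℝ → ℝ) (hF : ContDiff ℝ (⊤ : ℕ∞) F)
    (hper : ∀ (x : ℝ × ℝ) (m : ℤ × ℤ), F (x + ((m.1 : ℝ), (m.2 : ℝ))) = F x)
    (hreg : ∀ x, F x = 0 → fderiv ℝ F x ≠ 0) :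
    ∃ (γ : ℝ → ℝ × ℝ) (v : ℤ × ℤ),
      ContDiff ℝ (⊤ : ℕ∞) γ ∧ v ≠ 0 ∧
      (∀ t, γ (t + 1) = γ t + ((v.1 : ℝ), (v.2 : ℝ))) ∧
      ∀ t, F (γ t) ≠ 0 := by
  by_contra hcon
  have pN : Per (fun x => - F x) := fun x m => by simp only [hper x m]
  have no1 : ∀ x (v : ℤ × ℤ), RR F x (x + ((v.1 : ℝ), (v.2 : ℝ))) → v = 0 := by
    intro x v h
    by_contra hv
    obtain ⟨γ, h1, h2, h3⟩ := RR.loop hper h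
    exact hcon ⟨γ, v, h1, hv, h2, fun t => (h3 t).ne'⟩
  have no2 : ∀ x (v : ℤ × ℤ), RR (fun x => - F x) x (x + ((v.1 : ℝ), (v.2 : ℝ))) → v = 0 := by
    intro x v h
    by_contra hv
    obtain ⟨γ, h1, h2, h3⟩ := RR.loop pN h
    exact hcon ⟨γ, v, h1, hv, h2, fun t ht => by have := h3 t; simp [ht] at this⟩
  obtain ⟨u, a, su, pu, u0, a1, a2⟩ := lift_label hF hper hreg no1
  obtain ⟨w, b, sw, pw, w0, b1, b2⟩ := lift_label (G := fun x => - F x) hF.neg pN (by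
    intro x hx
    rw [fderiv_fun_neg]
    exact neg_ne_zero.2 (hreg x (neg_eq_zero.1 hx))) no2
  have K : IsCompact (Icc (0 : ℝ) 1 ×ˢ Icc (0 : ℝ) 1) := isCompact_Icc.prod isCompact_Icc
  have pos : ∀ x, 0 < max (u x) (w x) := by
    intro x
    rcases le_total 0 (F x) with h | h
    · exact lt_max_of_lt_left (u0 x h)
    · exact lt_max_of_lt_right (w0 x (by simpa using h))
  obtain ⟨x0, _, hx0⟩ := K.exists_isMinOn ⟨(0, 0), by simp⟩
    (su.continuous.max sw.continuous).continuousOn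
  obtain ⟨c, c0, hc⟩ : ∃ c : ℝ, 0 < c ∧ ∀ x, 2 * c < max (u x) (w x) := by
    refine ⟨max (u x0) (w x0) / 3, by have := pos x0; positivity, fun x => ?_⟩
    obtain ⟨m, hm⟩ := red x
    have h1 : max (u x0) (w x0) ≤ max (u (x + ((m.1 : ℝ), (m.2 : ℝ))))
      (w (x + ((m.1 : ℝ), (m.2 : ℝ)))) := hx0 hm
    rw [pu, pw] at h1
    have := pos x0
    linarith
  obtain ⟨p, sp, pp, hp⟩ := bump (b := fun x => ((a x).1 : ℝ)) (ContinuousLinearMap.fst ℝ ℝ ℝ) su pu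
    (fun x k hx => by simp [a1 x k hx])
    (fun x hx => (a2 x hx).mono fun y hy => by rw [hy]) c0
  obtain ⟨q, sq, pq, hq⟩ := bump (b := fun x => ((b x).2 : ℝ)) (ContinuousLinearMap.snd ℝ ℝ ℝ) sw pw
    (fun x k hx => by simp [b1 x k hx])
    (fun x hx => (b2 x hx).mono fun y hy => by rw [hy]) c0
  refine no_pq sp sq pp pq fun x => ?_
  rcases lt_max_iff.1 (hc x) with h | h
  · rw [hp x h]; simp
  · rw [hq x h]; simp
end

section
/- Let (f_n) be a sequence of continuous Gaussian fields on a compact metric space T converging almost surely in sup norm to a continuous Gaussian field f, with covariance functions K_n and K respectively. Then K_n converges to K uniformly on T × T. -/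
open MeasureTheory ProbabilityTheory Filter

theorem gauss_sq_aux {Ω : Type*} [MeasureSpace Ω] [IsProbabilityMeasure (volume : Measure Ω)]
    {X : Ω → ℝ} (hX : Measurable X) {v : NNReal}
    (h : Measure.map X volume = gaussianReal 0 v) :
    MemLp X 2 volume ∧ ∫ ω, (X ω) ^ 2 = v ∧
      ∫ ω, Complex.exp ((X ω : ℂ) * Complex.I) = (Real.exp (-(v : ℝ) / 2) : ℂ) := by
  have h2 : MemLp X 2 volume := by
    have := memLp_id_gaussianReal' (μ := 0) (v := v) 2 (by norm_num)
    rw [← h, memLp_map_measure_iff (by fun_prop) hX.aemeasurable] at this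
    exact this
  refine ⟨h2, ?_, ?_⟩
  · have h3 : ∫ x, x ^ 2 ∂(gaussianReal 0 v) = v := by
      have := variance_fun_id_gaussianReal (μ := 0) (v := v)
      rw [variance_eq_integral (by fun_prop)] at this
      simpa using this
    rw [← h3, ← h, integral_map hX.aemeasurable (by fun_prop)]
  · have h3 := charFun_gaussianReal (μ := 0) (v := v) 1
    rw [charFun_apply_real, ← h, integral_map hX.aemeasurable (by fun_prop)] at h3
    simp only [Complex.ofReal_one, one_mul] at h3
    rw [h3]
    push_cast
    congr 1
    simp
    ring

theorem gauss_conv_aux {Ω ι : Type*} [MeasureSpace Ω] [IsProbabilityMeasure (volume : Measure Ω)]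
    {l : Filter ι} [l.IsCountablyGenerated] {X : ι → Ω → ℝ} {Y : Ω → ℝ}
    (hX : ∀ i, Measurable (X i)) (hY : Measurable Y)
    (hGX : ∀ i, ∃ v : NNReal, Measure.map (X i) volume = gaussianReal 0 v)
    (hGY : ∃ v : NNReal, Measure.map Y volume = gaussianReal 0 v)
    (hc : ∀ᵐ ω, Tendsto (fun i => X i ω) l (nhds (Y ω))) :
    Tendsto (fun i => ∫ ω, (X i ω) ^ 2) l (nhds (∫ ω, (Y ω) ^ 2)) := by
  choose v hv using hGX
  obtain ⟨w, hw⟩ := hGY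
  have key : Tendsto (fun i => ∫ ω, Complex.exp ((X i ω : ℂ) * Complex.I)) l
      (nhds (∫ ω, Complex.exp ((Y ω : ℂ) * Complex.I))) := by
    refine tendsto_integral_filter_of_dominated_convergence (fun _ => (1 : ℝ)) ?_ ?_ ?_ ?_
    · refine Eventually.of_forall fun i => ?_
      have := hX i
      exact Measurable.aestronglyMeasurable (by fun_prop)
    · refine Eventually.of_forall fun i => Eventually.of_forall fun ω => ?_
      rw [Complex.norm_exp_ofReal_mul_I]
    · exact integrable_const _
    · filter_upwards [hc] with ω hω
      have hcont : Continuous fun x : ℝ => Complex.exp ((x : ℂ) * Complex.I) := by fun_prop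
      exact (hcont.tendsto _).comp hω
  simp only [(gauss_sq_aux (hX _) (hv _)).2.2, (gauss_sq_aux hY hw).2.2] at key
  simp only [(gauss_sq_aux (hX _) (hv _)).2.1, (gauss_sq_aux hY hw).2.1]
  have k2 := (Complex.continuous_re.tendsto _).comp key
  simp only [Function.comp_def, Complex.ofReal_re] at k2
  have k3 := (k2.log (Real.exp_pos _).ne').const_mul (-2)
  simp only [Real.log_exp] at k3
  convert k3 using 2
  · ring
  · ring_nf

theorem gauss_comb_aux {T Ω : Type*} [MeasureSpace Ω] (g : Ω → T → ℝ)
    (hG : ∀ (s : Finset T) (c : T → ℝ), ∃ v : NNReal,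
      Measure.map (fun ω => ∑ x ∈ s, c x * g ω x) volume = gaussianReal 0 v)
    (a b : ℝ) (x y : T) : ∃ v : NNReal,
      Measure.map (fun ω => a * g ω x + b * g ω y) volume = gaussianReal 0 v := by
  classical
  obtain ⟨v, hv⟩ := hG {x, y} (Pi.single x a + Pi.single y b)
  refine ⟨v, ?_⟩
  rw [← hv]
  congr 1
  funext ω
  simp [add_mul, Finset.sum_add_distrib, Pi.single_apply, ite_mul]

theorem gauss_cov_aux {T Ω : Type*} [MeasureSpace Ω] [IsProbabilityMeasure (volume : Measure Ω)]
    (g : Ω → T → ℝ) (hm : ∀ x, Measurable fun ω => g ω x)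
    (hG : ∀ (s : Finset T) (c : T → ℝ), ∃ v : NNReal,
      Measure.map (fun ω => ∑ x ∈ s, c x * g ω x) volume = gaussianReal 0 v)
    (x y : T) : ∫ ω, g ω x * g ω y =
      ((∫ ω, (1 * g ω x + 1 * g ω y) ^ 2) - ∫ ω, (1 * g ω x + (-1) * g ω y) ^ 2) / 4 := by
  have hx := hm x
  have hy := hm y
  obtain ⟨v, hv⟩ := gauss_comb_aux g hG 1 1 x y
  obtain ⟨w, hw⟩ := gauss_comb_aux g hG 1 (-1) x y
  have h1 := (gauss_sq_aux (by fun_prop) hv).1.integrable_sq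
  have h2 := (gauss_sq_aux (by fun_prop) hw).1.integrable_sq
  rw [← integral_sub h1 h2, ← integral_div]
  congr 1
  funext ω
  ring

theorem gauss_field_aux {T Ω ι : Type*} [MeasureSpace Ω] [IsProbabilityMeasure (volume : Measure Ω)]
    {l : Filter ι} [l.IsCountablyGenerated] (g : ι → Ω → T → ℝ) (f : Ω → T → ℝ)
    (hm : ∀ i x, Measurable fun ω => g i ω x) (hmf : ∀ x, Measurable fun ω => f ω x)
    (hG : ∀ i (s : Finset T) (c : T → ℝ), ∃ v : NNReal,
      Measure.map (fun ω => ∑ x ∈ s, c x * g i ω x) volume = gaussianReal 0 v)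
    (hGf : ∀ (s : Finset T) (c : T → ℝ), ∃ v : NNReal,
      Measure.map (fun ω => ∑ x ∈ s, c x * f ω x) volume = gaussianReal 0 v)
    (x y : ι → T) (x₀ y₀ : T)
    (hx : ∀ᵐ ω, Tendsto (fun i => g i ω (x i)) l (nhds (f ω x₀)))
    (hy : ∀ᵐ ω, Tendsto (fun i => g i ω (y i)) l (nhds (f ω y₀))) :
    Tendsto (fun i => ∫ ω, g i ω (x i) * g i ω (y i)) l (nhds (∫ ω, f ω x₀ * f ω y₀)) := by
  simp only [gauss_cov_aux (g _) (hm _) (hG _), gauss_cov_aux f hmf hGf]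
  have H : ∀ a b : ℝ, Tendsto (fun i => ∫ ω, (a * g i ω (x i) + b * g i ω (y i)) ^ 2) l
      (nhds (∫ ω, (a * f ω x₀ + b * f ω y₀) ^ 2)) := by
    intro a b
    refine gauss_conv_aux (fun i => ?_) ?_ (fun i => gauss_comb_aux (g i) (hG i) a b _ _)
      (gauss_comb_aux f hGf a b _ _) ?_
    · exact ((hm i _).const_mul a).add ((hm i _).const_mul b)
    · exact ((hmf _).const_mul a).add ((hmf _).const_mul b)
    · filter_upwards [hx, hy] with ω h1 h2
      exact (h1.const_mul a).add (h2.const_mul b)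
  exact ((H 1 1).sub (H 1 (-1))).div_const 4

/-- If a sequence of continuous centered Gaussian fields `f_n` on a compact metric space `T`
converges a.s. in sup norm to a continuous centered Gaussian field `f`, then the covariance
functions `K_n(x,y) = E[f_n(x)f_n(y)]` converge uniformly on `T × T` to `K(x,y) = E[f(x)f(y)]`. -/
theorem stmt_12 {T Ω : Type*} [MetricSpace T] [CompactSpace T]
    [MeasureSpace Ω] [IsProbabilityMeasure (volume : Measure Ω)]
    (fn : ℕ → Ω → C(T, ℝ)) (f : Ω → C(T, ℝ))
    (hmeas : ∀ n (x : T), Measurable fun ω => fn n ω x)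
    (hmeasf : ∀ x : T, Measurable fun ω => f ω x)
    (hGn : ∀ (n : ℕ) (s : Finset T) (c : T → ℝ), ∃ v : NNReal,
      Measure.map (fun ω => ∑ x ∈ s, c x * fn n ω x) volume = gaussianReal 0 v)
    (hG : ∀ (s : Finset T) (c : T → ℝ), ∃ v : NNReal,
      Measure.map (fun ω => ∑ x ∈ s, c x * f ω x) volume = gaussianReal 0 v)
    (hcent : ∀ n x, ∫ ω, fn n ω x = 0) (hcentf : ∀ x, ∫ ω, f ω x = 0)
    (hconv : ∀ᵐ ω, Tendsto (fun n => fn n ω) atTop (nhds (f ω))) :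
    TendstoUniformly (fun n (p : T × T) => ∫ ω, fn n ω p.1 * fn n ω p.2)
      (fun p => ∫ ω, f ω p.1 * f ω p.2) atTop := by
  rw [← tendstoLocallyUniformly_iff_tendstoUniformly_of_compactSpace,
    tendstoLocallyUniformly_iff_forall_tendsto]
  intro p
  have hq : Tendsto (fun q : ℕ × T × T => q.2) (atTop ×ˢ nhds p) (nhds p) := tendsto_snd
  have h1 : Tendsto (fun q : ℕ × T × T => q.2.1) (atTop ×ˢ nhds p) (nhds p.1) :=
    (continuous_fst.tendsto p).comp hq
  have h2 : Tendsto (fun q : ℕ × T × T => q.2.2) (atTop ×ˢ nhds p) (nhds p.2) :=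
    (continuous_snd.tendsto p).comp hq
  have A : ∀ (x : ℕ × T × T → T) (x₀ : T), Tendsto x (atTop ×ˢ nhds p) (nhds x₀) →
      ∀ᵐ ω, Tendsto (fun i : ℕ × T × T => fn i.1 ω (x i)) (atTop ×ˢ nhds p) (nhds (f ω x₀)) := by
    intro x x₀ hx
    filter_upwards [hconv] with ω hω
    have hc : Continuous fun z : C(T, ℝ) × T => z.1 z.2 := by fun_prop
    exact (hc.tendsto (f ω, x₀)).comp ((hω.comp tendsto_fst).prodMk_nhds hx)
  have B : ∀ (x : ℕ × T × T → T) (x₀ : T), Tendsto x (atTop ×ˢ nhds p) (nhds x₀) →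
      ∀ᵐ ω, Tendsto (fun i : ℕ × T × T => f ω (x i)) (atTop ×ˢ nhds p) (nhds (f ω x₀)) := by
    intro x x₀ hx
    exact Eventually.of_forall fun ω => ((f ω).continuous.tendsto x₀).comp hx
  have C1 := gauss_field_aux (l := atTop ×ˢ nhds p) (fun i ω x => fn i.1 ω x) (fun ω x => f ω x)
    (fun i => hmeas i.1) hmeasf (fun i => hGn i.1) hG (fun q => q.2.1) (fun q => q.2.2) p.1 p.2
    (A _ _ h1) (A _ _ h2)
  have C2 := gauss_field_aux (l := atTop ×ˢ nhds p) (fun (_ : ℕ × T × T) ω x => f ω x)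
    (fun ω x => f ω x)
    (fun _ => hmeasf) hmeasf (fun _ => hG) hG (fun q => q.2.1) (fun q => q.2.2) p.1 p.2
    (B _ _ h1) (B _ _ h2)
  exact (C2.prodMk_nhds C1).mono_right (nhds_le_uniformity _)
end
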